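/- arXiv:0905.4777 — 5 statements merged into one kernel-verified Lean document; each statement's English description precedes it below -/
import Mathlib

section
/- Let R be a commutative Noetherian regular local ring of Krull dimension d, with maximal ideal 𝔪 and residue field κ = R/𝔪. Then Ext^i_R(κ, R) = 0 for every i ≠ d, and Ext^d_R(κ, R) is isomorphic to κ as an R-module (equivalently, it is a one-dimensional κ-vector space). In other words, the projection R → κ is Gorenstein. -/
open CategoryTheory Opposite
open IsLocalRing in
lemma exists_prime_quot_dim (R : Type*) [CommRing R] (d : ℕ) (h : ringKrullDim R = d) :
    ∃ q : Ideal R, q.IsPrime ∧ (d : WithBot ℕ∞) ≤ ringKrullDim (R ⧸ q) := by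
  obtain ⟨l, hl⟩ := Order.le_krullDim_iff.mp (le_of_eq h.symm)
  refine ⟨l.head.asIdeal, l.head.2, ?_⟩
  rw [ringKrullDim_quotient, Order.le_krullDim_iff]
  refine ⟨⟨l.length, fun i => ⟨l i, ?_⟩, fun i => l.step i⟩, hl⟩
  exact LTSeries.head_le l i

open IsLocalRing RingTheory.Sequence Pointwise in
lemma regular_local_aux (d : ℕ) : ∀ (R : Type) [CommRing R] [IsNoetherianRing R] [IsLocalRing R]
    (_ : ringKrullDim R = d) (rs : List R) (_ : rs.length = d)
    (_ : Ideal.ofList rs = maximalIdeal R), IsDomain R ∧ IsWeaklyRegular R rs := by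
  induction d with
  | zero =>
    intro R _ _ _ hd rs hrs hm
    obtain rfl := List.length_eq_zero_iff.mp hrs
    rw [Ideal.ofList_nil] at hm
    have hf : IsField R := isField_iff_maximalIdeal_eq.mpr hm.symm
    exact ⟨hf.isDomain, by simp⟩
  | succ d ih =>
    intro R _ _ _ hd rs hrs hm
    match rs, hrs with
    | x :: xs, hrs =>
    have hxm : x ∈ maximalIdeal R := by
      rw [← hm]; exact Ideal.subset_span (by simp)
    have hntop : Ideal.span {x} ≠ ⊤ := fun h => by
      have : Ideal.span {x} ≤ maximalIdeal R := by simpa [Ideal.span_le] using hxm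
      exact (maximalIdeal.isMaximal R).ne_top (top_le_iff.mp (h ▸ this))
    have hnt : Nontrivial (R ⧸ Ideal.span {x}) := Ideal.Quotient.nontrivial_iff.mpr hntop
    have hloc : IsLocalRing (R ⧸ Ideal.span {x}) :=
      IsLocalRing.of_surjective' (Ideal.Quotient.mk _) Ideal.Quotient.mk_surjective
    have hlen : xs.length = d := by simpa using hrs
    set φ := Ideal.Quotient.mk (Ideal.span {x}) with hφ
    have hmax : Ideal.ofList (xs.map φ) = maximalIdeal (R ⧸ Ideal.span {x}) := by
      have h1 : (maximalIdeal R).map φ = maximalIdeal (R ⧸ Ideal.span {x}) :=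
        IsLocalRing.map_maximalIdeal_of_surjective φ Ideal.Quotient.mk_surjective
      have h0 : φ x = 0 := Ideal.Quotient.eq_zero_iff_mem.mpr (Ideal.mem_span_singleton_self x)
      rw [← h1, ← hm, Ideal.map_ofList, List.map_cons, Ideal.ofList_cons, h0]
      simp
    have hlow : ∀ (S : Type) [CommRing S] [IsNoetherianRing S] [IsLocalRing S] (y : S)
        (_ : y ∈ maximalIdeal S) (_ : ((d + 1 : ℕ) : WithBot ℕ∞) ≤ ringKrullDim S),
        (d : WithBot ℕ∞) ≤ ringKrullDim (S ⧸ Ideal.span {y}) := by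
      intro S _ _ _ y hy hS
      have := ringKrullDim_le_ringKrullDim_quotient_add_card ({y} : Finset S)
        (by rw [IsLocalRing.ringJacobson_eq_maximalIdeal]; simpa using hy)
      have := hS.trans this
      rw [Finset.coe_singleton] at this
      simp only [Finset.card_singleton, Nat.cast_add, Nat.cast_one] at this
      exact ENat.WithBot.add_le_add_one_right_iff.mp this
    have hdim : ringKrullDim (R ⧸ Ideal.span {x}) = d := by
      apply le_antisymm
      · refine (ringKrullDim_le_spanFinrank_maximalIdeal _).trans ?_
        rw [← hmax]
        have h2 : ((Ideal.ofList (xs.map φ)).spanFinrank) ≤ d := by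
          classical
          have := Submodule.spanFinrank_span_le_ncard_of_finite (R := R ⧸ Ideal.span {x})
            (s := {r | r ∈ xs.map φ}) (List.finite_toSet _)
          refine this.trans ?_
          have h3 : {r | r ∈ xs.map φ} = ((xs.map φ).toFinset : Set _) := by ext; simp
          rw [h3, Set.ncard_coe_finset]
          exact (List.toFinset_card_le _).trans (by simp [hlen])
        exact_mod_cast h2
      · exact hlow R x hxm hd.ge
    obtain ⟨hdom, hreg⟩ := ih (R ⧸ Ideal.span {x}) hdim (xs.map φ) (by simpa using hlen) hmax
    obtain ⟨q, hq, hqd⟩ := exists_prime_quot_dim R _ hd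
    have hqle : q ≤ Ideal.span {x} := by
      have hlocq : IsLocalRing (R ⧸ q) :=
        have : Nontrivial (R ⧸ q) := Ideal.Quotient.nontrivial_iff.mpr hq.ne_top
        IsLocalRing.of_surjective' (Ideal.Quotient.mk _) Ideal.Quotient.mk_surjective
      have h1 := hlow (R ⧸ q) (Ideal.Quotient.mk q x) (by
        rw [← IsLocalRing.map_maximalIdeal_of_surjective (Ideal.Quotient.mk q) Ideal.Quotient.mk_surjective]
        exact Ideal.mem_map_of_mem _ hxm) hqd
      have h2 : Ideal.span {Ideal.Quotient.mk q x} = (Ideal.span {x}).map (Ideal.Quotient.mk q) := by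
        rw [Ideal.map_span, Set.image_singleton]
      rw [h2, ringKrullDim_eq_of_ringEquiv (DoubleQuot.quotQuotEquivComm q (Ideal.span {x}))] at h1
      intro y hy
      by_contra hyx
      have hy0 : φ y ≠ 0 := fun h => hyx (Ideal.Quotient.eq_zero_iff_mem.mp h)
      have h3 := ringKrullDim_quotient_succ_le_of_nonZeroDivisor (mem_nonZeroDivisors_of_ne_zero hy0)
      have hle : Ideal.span {φ y} ≤ q.map φ := by
        rw [Ideal.span_singleton_le_iff_mem]; exact Ideal.mem_map_of_mem _ hy
      have h4 := ringKrullDim_le_of_surjective (Ideal.Quotient.factor hle)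
        (Ideal.Quotient.factor_surjective hle)
      have h5 := (add_le_add_left (h1.trans h4) 1).trans h3
      rw [hdim] at h5
      have : d + 1 ≤ d := by exact_mod_cast h5
      omega
    have hxq : x ∉ q := by
      intro hx
      have : q = Ideal.span {x} := le_antisymm hqle (by simpa [Ideal.span_le] using hx)
      rw [this, hdim] at hqd
      have : d + 1 ≤ d := by exact_mod_cast hqd
      omega
    have hqbot : q = ⊥ := by
      refine Submodule.eq_bot_of_le_smul_of_le_jacobson_bot (maximalIdeal R) q
        (IsNoetherian.noetherian q) ?_ ?_
      · intro y hy
        obtain ⟨a, rfl⟩ := Ideal.mem_span_singleton'.mp (hqle hy)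
        have ha : a ∈ q := (hq.mem_or_mem hy).resolve_right hxq
        rw [mul_comm]
        exact Submodule.smul_mem_smul hxm ha
      · exact (maximalIdeal_le_jacobson _)
    subst hqbot
    have hR : IsDomain R := (IsDomain.of_bot_isPrime R)
    refine ⟨hR, (isWeaklyRegular_cons_iff' R x xs).mpr ⟨?_, ?_⟩⟩
    · have hx0 : x ≠ 0 := by simpa using hxq
      intro a b hab
      exact mul_left_cancel₀ hx0 hab
    · let I1 : Ideal R := Ideal.span {x}
      have h : Ideal.span {x} = x • (⊤ : Ideal R) := by
        simp [← Submodule.ideal_span_singleton_smul]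
      let e : (R ⧸ Ideal.span {x}) ≃ₗ[R] QuotSMulTop x R := Submodule.quotEquivOfEq _ _ h
      have h6 := (isWeaklyRegular_map_algebraMap_iff (R ⧸ Ideal.span {x}) (R ⧸ Ideal.span {x}) xs).mp hreg
      exact (isWeaklyRegular_map_algebraMap_iff (R ⧸ Ideal.span {x}) (QuotSMulTop x R) xs).mpr
        ((e.isWeaklyRegular_congr xs).mp h6)


def ExtGood (R : Type) [CommRing R] (k : ℕ) (M : Type) [AddCommGroup M] [Module R M] : Prop :=
  (∀ i, i ≠ k → Subsingleton (Abelian.Ext (ModuleCat.of R M) (ModuleCat.of R R) i)) ∧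
  Nonempty (Abelian.Ext (ModuleCat.of R M) (ModuleCat.of R R) k ≃ₗ[R] M)

lemma ExtGood.of_equiv {R : Type} [CommRing R] {k : ℕ} {M N : Type} [AddCommGroup M] [Module R M]
    [AddCommGroup N] [Module R N] (e : M ≃ₗ[R] N) (h : ExtGood R k M) : ExtGood R k N := by
  let i : ModuleCat.of R M ≅ ModuleCat.of R N := e.toModuleIso
  have E : ∀ n, Nonempty (Abelian.Ext (ModuleCat.of R N) (ModuleCat.of R R) n ≃ₗ[R]
      Abelian.Ext (ModuleCat.of R M) (ModuleCat.of R R) n) := fun n => ⟨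
    { toFun := fun x => (Abelian.Ext.mk₀ i.hom).comp x (zero_add n)
      invFun := fun x => (Abelian.Ext.mk₀ i.inv).comp x (zero_add n)
      map_add' := by simp
      map_smul' := by simp
      left_inv := fun x => by simp
      right_inv := fun x => by simp }⟩
  refine ⟨fun n hn => ?_, ?_⟩
  · have := h.1 n hn
    exact (E n).some.toEquiv.subsingleton
  · exact ⟨(E k).some ≪≫ₗ h.2.some ≪≫ₗ e⟩

lemma ExtGood.self (R : Type) [CommRing R] : ExtGood R 0 R := by
  refine ⟨fun i hi => ?_, ?_⟩
  · obtain ⟨j, rfl⟩ := Nat.exists_eq_succ_of_ne_zero hi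
    have : Projective (ModuleCat.of R R) := inferInstance
    exact subsingleton_of_forall_eq 0 fun x => Abelian.Ext.eq_zero_of_projective x
  · exact ⟨Abelian.Ext.linearEquiv₀ (R := R) ≪≫ₗ ModuleCat.homLinearEquiv (S := R) ≪≫ₗ
      LinearMap.ringLmapEquivSelf R R R⟩

open Abelian in
open scoped Pointwise in
lemma ExtGood.quot_aux {R : Type} [CommRing R] {k : ℕ} {M : Type} [AddCommGroup M] [Module R M]
    {A C Y : ModuleCat.{0} R} (x : R) (hx : IsSMulRegular M x)
    (g : A ⟶ C) (w : (x • 𝟙 A) ≫ g = 0) (hS : (ShortComplex.mk (x • 𝟙 A) g w).ShortExact)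
    (h1 : ∀ i, i ≠ k → Subsingleton (Abelian.Ext A Y i)) (e : Abelian.Ext A Y k ≃ₗ[R] M) :
    (∀ i, i ≠ k + 1 → Subsingleton (Abelian.Ext C Y i)) ∧
    Nonempty (Abelian.Ext C Y (k + 1) ≃ₗ[R] QuotSMulTop x M) := by
  have hsm : ∀ i (y : Abelian.Ext A Y i),
      (Abelian.Ext.mk₀ (x • 𝟙 A)).comp y (zero_add i) = x • y := by
    intro i y
    rw [Ext.mk₀_smul, Ext.smul_comp, Ext.mk₀_id_comp]
  have hgz : ∀ i (y : Abelian.Ext C Y i), (Ext.mk₀ g).comp y (zero_add i) = 0 := by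
    intro i y
    by_cases hi : i = k
    · subst hi
      set z := (Ext.mk₀ g).comp y (zero_add i) with hz
      have h2 : x • z = 0 := by
        rw [← hsm, hz, Ext.mk₀_comp_mk₀_assoc, w]; simp
      have h3 : x • e z = x • (0 : M) := by
        rw [smul_zero, ← map_smul, h2, map_zero]
      exact e.injective ((hx h3).trans (map_zero e).symm)
    · have := h1 i hi
      exact Subsingleton.elim _ _
  have hz0 : ∀ y : Abelian.Ext C Y 0, y = 0 := by
    intro y
    have : Epi g := hS.epi_g
    exact Ext.precomp_mk₀_injective_of_epi Y g (by simpa using hgz 0 y)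
  have hex3 : ∀ i (y : Abelian.Ext C Y (i + 1)), ∃ v : Abelian.Ext A Y i,
      (show Abelian.Ext C A 1 from hS.extClass).comp v (add_comm 1 i) = y := fun i y =>
    Ext.contravariant_sequence_exact₃ hS Y y (hgz _ y) (add_comm 1 i)
  refine ⟨fun i hi => subsingleton_of_forall_eq 0 fun y => ?_, ?_⟩
  · obtain _ | i := i
    · exact hz0 y
    · obtain ⟨v, rfl⟩ := hex3 i y
      have := h1 i (by omega)
      rw [Subsingleton.elim v 0]; simp
  · let δ : Abelian.Ext A Y k →ₗ[R] Abelian.Ext C Y (k + 1) :=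
      { toFun := fun v => (show Abelian.Ext C A 1 from hS.extClass).comp v (add_comm 1 k)
        map_add' := by simp
        map_smul' := by simp }
    have hsurj : Function.Surjective δ := fun y => hex3 k y
    have hker : LinearMap.ker δ = (x • (⊤ : Submodule R M)).comap e.toLinearMap := by
      ext v
      simp only [LinearMap.mem_ker, Submodule.mem_comap, Submodule.mem_smul_pointwise_iff_exists]
      constructor
      · intro hv
        obtain ⟨u, hu⟩ := Ext.contravariant_sequence_exact₁ hS Y v (add_comm 1 k) hv
        have hu' : x • u = v := (hsm k u).symm.trans hu
        exact ⟨e u, trivial, by rw [← map_smul, hu']; rfl⟩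
      · rintro ⟨m, -, hm⟩
        have : v = x • e.symm m := by
          apply e.injective; rw [map_smul, e.apply_symm_apply]; exact hm.symm
        rw [this, ← hsm]
        exact hS.extClass_comp_assoc (h := Nat.add_comm 1 k) _
    refine ⟨(δ.quotKerEquivOfSurjective hsurj).symm ≪≫ₗ
      Submodule.Quotient.equiv _ _ e ?_⟩
    rw [hker]
    exact Submodule.map_comap_eq_of_surjective e.surjective _

lemma ExtGood.quot {R : Type} [CommRing R] {k : ℕ} {M : Type} [AddCommGroup M] [Module R M]
    (h : ExtGood R k M) (x : R) (hx : IsSMulRegular M x) :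
    ExtGood R (k + 1) (QuotSMulTop x M) := by
  have hS := IsSMulRegular.smulShortComplex_shortExact (M := ModuleCat.of R M) hx
  exact ExtGood.quot_aux (A := ModuleCat.of R M) (C := ModuleCat.of R (QuotSMulTop x M)) x hx
    (ModuleCat.smulShortComplex (ModuleCat.of R M) x).g
    (ModuleCat.smulShortComplex (ModuleCat.of R M) x).zero hS h.1 h.2.some

open RingTheory.Sequence in
lemma ExtGood.list {R : Type} [CommRing R] (rs : List R) : ∀ {k : ℕ} {M : Type} [AddCommGroup M]
    [Module R M] (_ : ExtGood R k M) (_ : IsWeaklyRegular M rs),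
    ExtGood R (k + rs.length) (M ⧸ (Ideal.ofList rs • ⊤ : Submodule R M)) := by
  induction rs with
  | nil =>
    intro k M _ _ h _
    exact h.of_equiv (Submodule.quotEquivOfEqBot _ (by simp)).symm
  | cons r rs ih =>
    intro k M _ _ h hr
    rw [isWeaklyRegular_cons_iff] at hr
    have := ih (h.quot r hr.1) hr.2
    rw [List.length_cons, show k + (rs.length + 1) = k + 1 + rs.length by omega]
    exact this.of_equiv (Submodule.quotOfListConsSMulTopEquivQuotSMulTopInner M r rs).symm


open CochainComplex.HomComplex in
lemma extMk_zero_eq_zero {C : Type*} [Category C] [Abelian C] [HasExt C] {X Y : C}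
    (P : ProjectiveResolution X) (f : P.complex.X 0 ⟶ Y) (hf : P.complex.d 1 0 ≫ f = 0)
    (h : P.extMk f 1 rfl hf = 0) : f = 0 := by
  rw [← P.extEquivCohomologyClass.apply_eq_iff_eq,
    ProjectiveResolution.extEquivCohomologyClass_extMk,
    ProjectiveResolution.extEquivCohomologyClass_zero,
    CohomologyClass.mk_eq_zero_iff,
    Cocycle.toSingleMk_mem_coboundaries_iff _ _ _ _ _ 1 (by simp)] at h
  obtain ⟨g, hg⟩ := h
  have hz : Limits.IsZero (P.cochainComplex.X 1) :=
    CochainComplex.isZero_of_isStrictlyLE _ 0 _ (by simp)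
  rw [hz.eq_of_src g 0, Limits.comp_zero] at hg
  rw [← cancel_epi (P.cochainComplexXIso (-(0:ℕ)) 0 rfl).hom, ← hg, Limits.comp_zero]

lemma smul_extMk_aux {R : Type} [CommRing R] {X Y : ModuleCat.{0} R} (P : ProjectiveResolution X)
    (r : R) {n : ℕ} (f : P.complex.X n ⟶ Y) (m : ℕ) (hm : n + 1 = m)
    (hf : P.complex.d m n ≫ f = 0) :
    r • P.extMk f m hm hf = P.extMk (r • f) m hm (by simp [hf]) := by
  rw [Abelian.Ext.smul_eq_comp_mk₀, P.extMk_comp_mk₀]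
  congr 1

lemma oldExt_iso (R : Type) [CommRing R] (X Y : ModuleCat.{0} R) (n : ℕ) :
    Nonempty ((((Ext R (ModuleCat R) n).obj (op X)).obj Y) ≅
      ModuleCat.of R (Abelian.Ext X Y n)) := by
  let P := projectiveResolution X
  let K := P.complex.linearYonedaObj R Y
  have hn : (ComplexShape.up ℕ).next n = n + 1 := by simp
  let S := K.sc' ((ComplexShape.up ℕ).prev n) n (n + 1)
  have hg : ∀ f : P.complex.X n ⟶ Y, S.g.hom f = P.complex.d (n+1) n ≫ f := fun f => rfl
  have hf : ∀ f : P.complex.X ((ComplexShape.up ℕ).prev n) ⟶ Y,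
    S.f.hom f = P.complex.d n _ ≫ f := fun f => rfl
  let φ : LinearMap.ker S.g.hom →ₗ[R] Abelian.Ext X Y n :=
    { toFun := fun f => P.extMk (f.1 : P.complex.X n ⟶ Y) (n+1) rfl f.2
      map_add' := fun f g => (P.add_extMk _ _ _ _ _ _).symm
      map_smul' := fun r f => (smul_extMk_aux P r (f.1 : P.complex.X n ⟶ Y) _ rfl f.2).symm }
  have hsurj : Function.Surjective φ := fun α => by
    obtain ⟨f, hf, rfl⟩ := P.extMk_surjective α (n+1) rfl
    exact ⟨⟨f, hf⟩, rfl⟩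
  have hker : LinearMap.range S.moduleCatToCycles = LinearMap.ker φ := by
    ext f
    obtain ⟨f, hfz⟩ := f
    have key : P.extMk (f : P.complex.X n ⟶ Y) (n+1) rfl hfz = 0 ↔
        ∃ g : P.complex.X ((ComplexShape.up ℕ).prev n) ⟶ Y, P.complex.d n _ ≫ g = f := by
      obtain _ | p := n
      · constructor
        · intro h
          exact ⟨0, by rw [Limits.comp_zero]; exact (extMk_zero_eq_zero P f hfz h).symm⟩
        · rintro ⟨g, hg⟩
          rw [P.complex.shape _ _ (by simp), Limits.zero_comp] at hg
          subst hg
          exact P.extMk_zero _ _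
      · have hp : (ComplexShape.up ℕ).prev (p+1) = p := by simp
        rw [hp]
        exact P.extMk_eq_zero_iff f _ rfl hfz p rfl
    refine Iff.trans ?_ key.symm
    constructor
    · rintro ⟨g, hg⟩; exact ⟨g, congrArg Subtype.val hg⟩
    · rintro ⟨g, hg⟩; exact ⟨g, Subtype.ext hg⟩
  let e : (LinearMap.ker S.g.hom ⧸ LinearMap.range S.moduleCatToCycles) ≃ₗ[R]
      Abelian.Ext X Y n :=
    Submodule.quotEquivOfEq _ _ hker ≪≫ₗ φ.quotKerEquivOfSurjective hsurj
  exact ⟨P.isoExt n Y ≪≫ ShortComplex.homologyMapIso (K.isoSc' _ n _ rfl hn) ≪≫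
    S.moduleCatHomologyIso ≪≫ e.toModuleIso⟩

theorem stmt_0 (R : Type) [CommRing R] [IsNoetherianRing R] [IsLocalRing R]
    (d : ℕ) (hdim : ringKrullDim R = d)
    (hreg : ∃ s : Finset R, s.card = d ∧
      Ideal.span (s : Set R) = IsLocalRing.maximalIdeal R) :
    (∀ i : ℕ, i ≠ d →
      Subsingleton (((Ext R (ModuleCat R) i).obj
        (op (ModuleCat.of R (IsLocalRing.ResidueField R)))).obj (ModuleCat.of R R))) ∧
    Nonempty ((((Ext R (ModuleCat R) d).obj
        (op (ModuleCat.of R (IsLocalRing.ResidueField R)))).obj (ModuleCat.of R R)) ≅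
      ModuleCat.of R (IsLocalRing.ResidueField R)) := by
  obtain ⟨s, hs, hsp⟩ := hreg
  have hlen : s.toList.length = d := by rw [Finset.length_toList, hs]
  have hmax : Ideal.ofList s.toList = IsLocalRing.maximalIdeal R := by
    rw [← hsp]
    unfold Ideal.ofList
    congr 1
    ext x
    simp
  have hw := (regular_local_aux d R hdim s.toList hlen hmax).2
  have good := ExtGood.list s.toList (ExtGood.self R) hw
  rw [zero_add, hlen] at good
  have heq : (Ideal.ofList s.toList • ⊤ : Submodule R R) = IsLocalRing.maximalIdeal R := by
    rw [hmax, smul_eq_mul, Ideal.mul_top]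
  have good2 : ExtGood R d (IsLocalRing.ResidueField R) :=
    good.of_equiv (Submodule.quotEquivOfEq _ _ heq)
  refine ⟨fun i hi => ?_, ?_⟩
  · obtain ⟨e⟩ := oldExt_iso R (ModuleCat.of R (IsLocalRing.ResidueField R)) (ModuleCat.of R R) i
    have := good2.1 i hi
    exact e.toLinearEquiv.toEquiv.subsingleton
  · obtain ⟨e⟩ := oldExt_iso R (ModuleCat.of R (IsLocalRing.ResidueField R)) (ModuleCat.of R R) d
    obtain ⟨f⟩ := good2.2
    exact ⟨e ≪≫ f.toModuleIso⟩
end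

section
/- Let K be a finite unramified extension of ℚ_p with ring of integers W. For every finite length W-module M there is an isomorphism of W-modules Ext^1_W(M, W) ≅ Hom_{ℤ_p}(M, ℚ_p/ℤ_p), where W acts on the right-hand side through its action on M; that is, Gorenstein duality over W agrees with Pontryagin duality on finite length W-modules. -/
open CategoryTheory Opposite

theorem aux_glue {R : Type} [CommRing R] (S : ShortComplex (ModuleCat.{0} R))
    {T : Type} [AddCommGroup T] (act : R → T → T) (Rel : S.X₂ → T → Prop)
    (hex : ∀ f, S.g.hom f = 0 → ∃ t, Rel f t)
    (huniq : ∀ f t t', Rel f t → Rel f t' → t = t')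
    (hadd : ∀ f f' t t', Rel f t → Rel f' t' → Rel (f + f') (t + t'))
    (hact : ∀ (w : R) f t, Rel f t → Rel (w • f) (act w t))
    (hsurj : ∀ t, ∃ f, S.g.hom f = 0 ∧ Rel f t)
    (hker : ∀ f, Rel f 0 ↔ ∃ h, S.f.hom h = f) :
    ∃ e : S.homology ≃+ T, ∀ (w : R) x, e (w • x) = act w (e x) := by
  choose φ hφ using hex
  let Φ : LinearMap.ker S.g.hom →+ T :=
    AddMonoidHom.mk' (fun f => φ f.1 f.2) (fun a b =>
      huniq _ _ _ (hφ _ _) (hadd _ _ _ _ (hφ _ _) (hφ _ _)))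
  have hΦ : ∀ f : LinearMap.ker S.g.hom, Rel f.1 (Φ f) := fun f => hφ _ _
  have hΦact : ∀ (w : R) f, Φ (w • f) = act w (Φ f) := fun w f =>
    huniq _ _ _ (hΦ _) (hact _ _ _ (hΦ _))
  have hΦs : Function.Surjective Φ := fun t => by
    obtain ⟨f, hf, hr⟩ := hsurj t
    exact ⟨⟨f, hf⟩, huniq _ _ _ (hΦ _) hr⟩
  have hΦk : (LinearMap.range S.moduleCatToCycles).toAddSubgroup = Φ.ker := by
    ext f
    rw [AddMonoidHom.mem_ker]
    have : Φ f = 0 ↔ Rel f.1 0 := ⟨fun h => h ▸ hΦ f, fun h => huniq _ _ _ (hΦ f) h⟩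
    rw [this, hker]
    constructor
    · rintro ⟨h, rfl⟩; exact ⟨h, rfl⟩
    · rintro ⟨h, hh⟩; exact ⟨h, Subtype.ext hh⟩
  let e2 : (LinearMap.ker S.g.hom ⧸ LinearMap.range S.moduleCatToCycles) ≃+ T :=
    (QuotientAddGroup.quotientAddEquivOfEq hΦk).trans
      (QuotientAddGroup.quotientKerEquivOfSurjective Φ hΦs)
  have he2 : ∀ f, e2 (Submodule.Quotient.mk f) = Φ f := fun f => rfl
  let e1 : S.homology ≃ₗ[R] (LinearMap.ker S.g.hom ⧸ LinearMap.range S.moduleCatToCycles) :=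
    S.moduleCatHomologyIso.toLinearEquiv
  refine ⟨e1.toAddEquiv.trans e2, fun w x => ?_⟩
  change e2 (e1 (w • x)) = act w (e2 (e1 x))
  rw [map_smul]
  obtain ⟨f, hf⟩ := Submodule.Quotient.mk_surjective _ (e1 x)
  rw [← hf, ← Submodule.Quotient.mk_smul, he2, he2, hΦact]

theorem aux_baer (A F : Type) [CommRing A] [IsDomain A] [IsPrincipalIdealRing A] [Field F]
    [Algebra A F] [IsFractionRing A F] : Module.Baer A F := by
  intro I g
  obtain ⟨a, rfl⟩ := (IsPrincipalIdealRing.principal I).principal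
  by_cases ha : a = 0
  · refine ⟨0, fun x hx => ?_⟩
    have : x = 0 := by simpa [ha] using hx
    have h2 : (⟨x, hx⟩ : Submodule.span A {a}) = 0 := Subtype.ext this
    rw [h2]; simp
  · have haF : algebraMap A F a ≠ 0 := by simpa using ha
    have hmem : a ∈ Submodule.span A {a} := Submodule.mem_span_singleton_self a
    refine ⟨LinearMap.toSpanSingleton A F (g ⟨a, hmem⟩ / algebraMap A F a), fun x hx => ?_⟩
    obtain ⟨c, rfl⟩ := Submodule.mem_span_singleton.1 hx
    have h2 : (⟨c • a, hx⟩ : Submodule.span A {a}) = c • ⟨a, hmem⟩ := rfl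
    have h3 : g (c • ⟨a, hmem⟩) = c • g ⟨a, hmem⟩ := map_smul g c _
    rw [h2, h3]
    simp only [LinearMap.toSpanSingleton_apply, smul_eq_mul]
    rw [Algebra.smul_def, Algebra.smul_def, map_mul]
    field_simp

theorem aux_tors {R : Type} [CommRing R] [IsLocalRing R] (p : R)
    (hp : p ∈ IsLocalRing.maximalIdeal R) {M : Type} [AddCommGroup M] [Module R M]
    (hM : IsFiniteLength R M) (m : M) : ∃ n : ℕ, p ^ n • m = 0 := by
  have := (isFiniteLength_iff_isNoetherian_isArtinian.1 hM).2
  have hm : m ∈ Submodule.span R {m} := Submodule.mem_span_singleton_self m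
  obtain ⟨n, ⟨y, hy⟩, h⟩ := IsArtinian.exists_pow_succ_smul_dvd p
    (⟨m, hm⟩ : Submodule.span R {m})
  obtain ⟨c, rfl⟩ := Submodule.mem_span_singleton.1 hy
  have h' : p ^ (n+1) • c • m = p ^ n • m := congrArg Subtype.val h
  refine ⟨n, ?_⟩
  have hu : IsUnit (1 - p * c) := by
    by_contra hc
    exact (IsLocalRing.maximalIdeal.isMaximal R).ne_top ((Ideal.eq_top_iff_one _).2 (by
      have := Ideal.add_mem _ ((IsLocalRing.mem_maximalIdeal _).2 hc)
        (Ideal.mul_mem_right c _ hp)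
      simpa using this))
  rw [← hu.smul_left_cancel (x := p ^ n • m), smul_zero, sub_smul, one_smul, sub_eq_zero]
  nth_rewrite 1 [← h']
  rw [smul_smul, smul_smul]
  congr 1
  ring

section
variable {A F W : Type} [CommRing A] [IsDomain A] [IsPrincipalIdealRing A] [Field F]
  [Algebra A F] [IsFractionRing A F] [CommRing W] [Algebra A W]
  (lam : W →ₗ[A] A) (hinj : ∀ w, (∀ v, lam (w * v) = 0) → w = 0)
  (hsur : ∀ g : W →ₗ[A] A, ∃ w, ∀ v, lam (w * v) = g v)
  {P2 P1 P0 M : Type} 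
  [AddCommGroup P2] [AddCommGroup P1] [AddCommGroup P0] [AddCommGroup M] 
  [Module W P2] [Module W P1] [Module W P0] [Module W M] 
  [Module A P1] [Module A P0] [Module A M] 
  [IsScalarTower A W P1] [IsScalarTower A W P0] [IsScalarTower A W M]
  (d2 : P2 →ₗ[W] P1) (d1 : P1 →ₗ[W] P0) (π : P0 →ₗ[W] M)

include hinj in
theorem aux_lam_ext (f f' : P1 →ₗ[W] W) (h : ∀ x, lam (f x) = lam (f' x)) : f = f' := by
  ext x
  rw [← sub_eq_zero]
  refine hinj _ fun v => ?_
  rw [sub_mul, map_sub, sub_eq_zero, mul_comm, mul_comm _ v]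
  simpa using h (v • x)

include hinj hsur in
theorem aux_lam_lift (g : P1 →ₗ[A] A) : ∃ f : P1 →ₗ[W] W, ∀ x, lam (f x) = g x := by
  have : ∀ x : P1, ∃ w, ∀ v : W, lam (w * v) = g (v • x) := fun x =>
    hsur (g ∘ₗ ((LinearMap.toSpanSingleton W P1 x).restrictScalars A))
  choose f hf using this
  have heq : ∀ w w' : W, (∀ v, lam (w * v) = lam (w' * v)) → w = w' := fun w w' h => by
    rw [← sub_eq_zero]
    exact hinj _ fun v => by rw [sub_mul, map_sub, h, sub_self]
  refine ⟨⟨⟨f, fun x y => heq _ _ fun v => ?_⟩, fun c x => heq _ _ fun v => ?_⟩, fun x => ?_⟩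
  · rw [add_mul, map_add, hf, hf, hf, smul_add, map_add]
  · have : c * f x * v = f x * (c * v) := by ring
    simp only [RingHom.id_apply, smul_eq_mul]
    rw [hf, this, hf, mul_comm, mul_smul]
  · simpa using hf x 1

variable (F) in
def auxRel (f : P1 →ₗ[W] W)
    (t : M →ₗ[A] (F ⧸ LinearMap.range (Algebra.linearMap A F))) : Prop :=
  ∃ g : P0 →ₗ[A] F, (∀ y, g (d1 y) = algebraMap A F (lam (f y))) ∧
    ∀ x, t (π x) = Submodule.Quotient.mk (g x)

theorem auxRel_add (f f' : P1 →ₗ[W] W) (t t') (h : auxRel F lam d1 π f t)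
    (h' : auxRel F lam d1 π f' t') : auxRel F lam d1 π (f + f') (t + t') := by
  obtain ⟨g, h1, h2⟩ := h
  obtain ⟨g', h1', h2'⟩ := h'
  exact ⟨g + g', fun y => by simp [h1, h1'], fun x => by simp [h2, h2']⟩

theorem auxRel_smul (w : W) (f : P1 →ₗ[W] W) (t) (h : auxRel F lam d1 π f t) :
    auxRel F lam d1 π (w • f) (t ∘ₗ (DistribSMul.toLinearMap A M w)) := by
  obtain ⟨g, h1, h2⟩ := h
  refine ⟨g ∘ₗ (DistribSMul.toLinearMap A P0 w), fun y => ?_, fun x => ?_⟩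
  · change g (w • d1 y) = algebraMap A F (lam ((w • f) y))
    rw [← map_smul, h1, map_smul, LinearMap.smul_apply]
  · change t (w • π x) = Submodule.Quotient.mk (g (w • x))
    rw [← map_smul, h2]

variable (hπ : Function.Surjective π) (h1 : Function.Exact d1 π) (h2 : Function.Exact d2 d1)
  (htors : ∀ m : M, ∃ a : A, a ≠ 0 ∧ a • m = 0)

include h1 htors in
theorem aux_tors_ext (g g' : P0 →ₗ[A] F) (h : ∀ y, g (d1 y) = g' (d1 y)) : g = g' := by
  ext x
  obtain ⟨a, ha, hx⟩ := htors (π x)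
  have : π (a • x) = 0 := by rw [LinearMap.map_smul_of_tower, hx]
  obtain ⟨y, hy⟩ := (h1 _).1 this
  have h3 := h y
  rw [hy, map_smul, map_smul, Algebra.smul_def, Algebra.smul_def] at h3
  exact mul_left_cancel₀ (by simpa using ha) h3

include hπ h1 htors in
theorem auxRel_uniq (f : P1 →ₗ[W] W) (t t') (h : auxRel F lam d1 π f t)
    (h' : auxRel F lam d1 π f t') : t = t' := by
  obtain ⟨g, h3, h4⟩ := h
  obtain ⟨g', h3', h4'⟩ := h'
  have : g = g' := aux_tors_ext d1 π h1 htors g g' fun y => by rw [h3, h3']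
  subst this
  ext x
  obtain ⟨x, rfl⟩ := hπ x
  rw [h4, h4']

include hπ h1 h2 in
theorem auxRel_ex (f : P1 →ₗ[W] W) (hf : f ∘ₗ d2 = 0) : ∃ t, auxRel F lam d1 π f t := by
  have hinjF := (aux_baer A F).injective
  have hk : LinearMap.ker (d1.restrictScalars A) ≤ LinearMap.ker
      ((Algebra.linearMap A F) ∘ₗ lam ∘ₗ (f.restrictScalars A)) := by
    intro y hy
    obtain ⟨z, rfl⟩ := (h2 y).1 hy
    have : f (d2 z) = 0 := LinearMap.congr_fun hf z
    simp [this]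
  obtain ⟨g, hg⟩ := hinjF.out (Submodule.liftQ _ (d1.restrictScalars A) le_rfl)
    (LinearMap.ker_eq_bot.1 (Submodule.ker_liftQ_eq_bot _ _ _ le_rfl))
    (Submodule.liftQ _ _ hk)
  have hg' : ∀ y, g (d1 y) = algebraMap A F (lam (f y)) := fun y =>
    hg (Submodule.Quotient.mk y)
  have hk2 : LinearMap.ker (π.restrictScalars A) ≤ LinearMap.ker
      ((LinearMap.range (Algebra.linearMap A F)).mkQ ∘ₗ g) := by
    intro x hx
    obtain ⟨y, rfl⟩ := (h1 x).1 hx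
    simp [hg']
  let e := (π.restrictScalars A).quotKerEquivOfSurjective hπ
  refine ⟨(Submodule.liftQ _ _ hk2) ∘ₗ e.symm.toLinearMap, g, hg', fun x => ?_⟩
  have : e.symm (π x) = Submodule.Quotient.mk x := by
    rw [LinearEquiv.symm_apply_eq]; rfl
  change (Submodule.liftQ _ _ hk2) (e.symm (π x)) = _
  rw [this]
  rfl

include hinj hsur h1 h2 in
theorem auxRel_surj [Module.Projective A P0]
    (t : M →ₗ[A] (F ⧸ LinearMap.range (Algebra.linearMap A F))) :
    ∃ f : P1 →ₗ[W] W, f ∘ₗ d2 = 0 ∧ auxRel F lam d1 π f t := by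
  obtain ⟨g, hg⟩ := Module.projective_lifting_property
    (LinearMap.range (Algebra.linearMap A F)).mkQ (t ∘ₗ π.restrictScalars A)
    (Submodule.mkQ_surjective _)
  have hg' : ∀ x, t (π x) = Submodule.Quotient.mk (g x) := fun x =>
    (LinearMap.congr_fun hg x).symm
  have hr : ∀ y, ∃ a, algebraMap A F a = g (d1 y) := fun y => by
    have h3 := hg' (d1 y)
    rw [h1.apply_apply_eq_zero, map_zero] at h3
    exact (Submodule.Quotient.mk_eq_zero _).1 h3.symm
  choose b hb using hr
  have hFi : Function.Injective (algebraMap A F) := IsFractionRing.injective A F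
  obtain ⟨f, hf⟩ := aux_lam_lift lam hinj hsur
    (⟨⟨b, fun x y => hFi (by simp [hb])⟩, fun c x => hFi (by
      simp [hb, LinearMap.map_smul_of_tower, Algebra.smul_def])⟩ : P1 →ₗ[A] A)
  refine ⟨f, ?_, g, fun y => ?_, hg'⟩
  · let : Module A P2 := Module.compHom P2 (algebraMap A W)
    have : IsScalarTower A W P2 := ⟨fun a w x => by
      rw [Algebra.smul_def, mul_smul]; rfl⟩
    refine aux_lam_ext lam hinj _ _ fun x => ?_
    have : b (d2 x) = 0 := hFi (by simp [hb, h2.apply_apply_eq_zero])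
    simpa [this] using hf (d2 x)
  · rw [hf]; exact (hb y).symm

include hinj hsur in
theorem auxRel_ker (f : P1 →ₗ[W] W) :
    auxRel F lam d1 π f 0 ↔ ∃ h : P0 →ₗ[W] W, h ∘ₗ d1 = f := by
  have hFi : Function.Injective (algebraMap A F) := IsFractionRing.injective A F
  constructor
  · rintro ⟨g, h3, h4⟩
    have hr : ∀ y, ∃ a, algebraMap A F a = g y := fun y => 
      (Submodule.Quotient.mk_eq_zero _).1 (h4 y).symm
    choose b hb using hr
    obtain ⟨h, hh⟩ := aux_lam_lift lam hinj hsur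
      (⟨⟨b, fun x y => hFi (by simp [hb])⟩, fun c x => hFi (by
        simp [hb, Algebra.smul_def])⟩ : P0 →ₗ[A] A)
    refine ⟨h, aux_lam_ext lam hinj _ _ fun x => hFi ?_⟩
    rw [← h3]
    simp [hh, hb]
  · rintro ⟨h, rfl⟩
    refine ⟨(Algebra.linearMap A F) ∘ₗ lam ∘ₗ (h.restrictScalars A), fun y => rfl, fun x => ?_⟩
    symm
    rw [LinearMap.zero_apply, Submodule.Quotient.mk_eq_zero]
    exact ⟨_, rfl⟩
end

theorem aux_lam_exists {A W : Type} [CommRing A] [IsDomain A] [IsLocalRing A]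
    [CommRing W] [IsLocalRing W] [Algebra A W] [Module.Free A W] [Module.Finite A W] (p : A)
    (hpA : IsLocalRing.maximalIdeal A = Ideal.span {p})
    (hp : IsLocalRing.maximalIdeal W = Ideal.span {algebraMap A W p}) :
    ∃ lam : W →ₗ[A] A, (∀ w, (∀ v, lam (w * v) = 0) → w = 0) ∧
      (∀ g : W →ₗ[A] A, ∃ w, ∀ v, lam (w * v) = g v) := by
  classical
  let b := Module.Free.chooseBasis A W
  have : Nonempty (Module.Free.ChooseBasisIndex A W) := b.index_nonempty
  let i0 := Classical.arbitrary (Module.Free.ChooseBasisIndex A W)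
  let lam := b.coord i0
  have hlam : lam (b i0) = 1 := by simp [lam]
  refine ⟨lam, ?_⟩
  let φ : W →ₗ[A] (W →ₗ[A] A) := (LinearMap.mul A W).compr₂ lam
  suffices h : Function.Bijective φ by
    refine ⟨fun w hw => ?_, fun g => ?_⟩
    · exact h.1 (by ext v; simpa [φ] using hw v)
    · obtain ⟨w, rfl⟩ := h.2 g
      exact ⟨w, fun v => rfl⟩
  let N := LinearMap.toMatrix b b.dualBasis φ
  have hN : ∀ i j, N i j = lam (b j * b i) := fun i j => by
    simp [N, LinearMap.toMatrix_apply, φ]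
  have hu : IsUnit N.det := by
    by_contra hc
    rw [← IsLocalRing.notMem_maximalIdeal, not_not, ← IsLocalRing.residue_eq_zero_iff,
      RingHom.map_det] at hc
    obtain ⟨v, hv0, hv⟩ := Matrix.exists_mulVec_eq_zero_iff.2 hc
    choose u hu using fun i => IsLocalRing.residue_surjective (R := A) (v i)
    let w : W := ∑ i, u i • b i
    have hw : IsUnit w := by
      by_contra hc
      rw [← IsLocalRing.notMem_maximalIdeal, not_not, hp, Ideal.mem_span_singleton] at hc
      obtain ⟨z, hz⟩ := hc
      apply hv0
      ext i
      have h3 : b.repr w i = u i := by simp [w, Finsupp.single_apply]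
      rw [hz, ← Algebra.smul_def, map_smul] at h3
      rw [← hu, ← h3, Pi.zero_apply, IsLocalRing.residue_eq_zero_iff, hpA,
        Ideal.mem_span_singleton]
      exact ⟨_, rfl⟩
    have h4 : ∀ i, lam (w * b i) ∈ IsLocalRing.maximalIdeal A := fun i => by
      rw [← IsLocalRing.residue_eq_zero_iff]
      have := congrFun hv i
      simp only [Matrix.mulVec, dotProduct, RingHom.mapMatrix_apply, Matrix.map_apply, hN,
        Pi.zero_apply, ← hu, ← map_mul, ← map_sum] at this
      rw [← this]
      congr 1
      simp only [w, Finset.sum_mul, map_sum, smul_mul_assoc, map_smul, smul_eq_mul]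
      exact Finset.sum_congr rfl fun _ _ => mul_comm _ _
    have h5 : ∀ x, lam (w * x) ∈ IsLocalRing.maximalIdeal A := fun x => by
      rw [← b.sum_repr x, Finset.mul_sum, map_sum]
      refine Ideal.sum_mem _ fun i _ => ?_
      rw [mul_smul_comm, map_smul]
      exact Ideal.mul_mem_left _ _ (h4 i)
    obtain ⟨w', hw'⟩ := hw.exists_right_inv
    have h6 := h5 (w' * b i0)
    rw [← mul_assoc, hw', one_mul, hlam] at h6
    exact (Ideal.ne_top_iff_one _).1 (IsLocalRing.maximalIdeal.isMaximal A).ne_top h6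
  have : φ = (LinearEquiv.ofIsUnitDet hu).toLinearMap := by ext; rfl
  rw [this]
  exact LinearEquiv.bijective _

theorem aux_main {A F W : Type} [CommRing A] [IsDomain A] [IsPrincipalIdealRing A] [Field F]
    [Algebra A F] [IsFractionRing A F] [CommRing W] [Algebra A W] [Module.Free A W]
    (lam : W →ₗ[A] A) (hinj : ∀ w, (∀ v, lam (w * v) = 0) → w = 0)
    (hsur : ∀ g : W →ₗ[A] A, ∃ w, ∀ v, lam (w * v) = g v)
    {M : Type} [AddCommGroup M] [Module W M] [Module A M] [IsScalarTower A W M]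
    (htors : ∀ m : M, ∃ a : A, a ≠ 0 ∧ a • m = 0) :
    ∃ e : (((Ext W (ModuleCat.{0} W) 1).obj (op (ModuleCat.of W M))).obj (ModuleCat.of W W)) ≃+
          (M →ₗ[A] (F ⧸ LinearMap.range (Algebra.linearMap A F))),
      ∀ (w : W) (x), e (w • x) = (e x) ∘ₗ (DistribSMul.toLinearMap A M w) := by
  let P := projectiveResolution (ModuleCat.of W M)
  let C := P.complex.linearYonedaObj W (ModuleCat.of W W)
  let i1 : ((Ext W (ModuleCat.{0} W) 1).obj (op (ModuleCat.of W M))).obj (ModuleCat.of W W) ≅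
    (C.sc' 0 1 2).homology := P.isoExt 1 _ ≪≫
      ShortComplex.homologyMapIso (C.isoSc' 0 1 2 (by simp) (by simp))
  let P0 := P.complex.X 0
  let P1 := P.complex.X 1
  let P2 := P.complex.X 2
  let mA0 : Module A P0 := Module.compHom P0 (algebraMap A W)
  let mA1 : Module A P1 := Module.compHom P1 (algebraMap A W)
  have t0 : IsScalarTower A W P0 := ⟨fun a w x => by rw [Algebra.smul_def, mul_smul]; rfl⟩
  have t1 : IsScalarTower A W P1 := ⟨fun a w x => by rw [Algebra.smul_def, mul_smul]; rfl⟩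
  let d2 : P2 →ₗ[W] P1 := (P.complex.d 2 1).hom
  let d1 : P1 →ₗ[W] P0 := (P.complex.d 1 0).hom
  let π : P0 →ₗ[W] M := (P.π.f 0).hom
  have h2 : Function.Exact d2 d1 :=
    (ShortComplex.ShortExact.moduleCat_exact_iff_function_exact _).1 (P.exact_succ 0)
  have h1 : Function.Exact d1 π :=
    (ShortComplex.ShortExact.moduleCat_exact_iff_function_exact _).1 P.exact₀
  have hπ : Function.Surjective π :=
    (ModuleCat.epi_iff_surjective (P.π.f 0)).1 inferInstance
  have hp : Module.Projective W P0 := (IsProjective.iff_projective (P.complex.X 0)).2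
    (P.projective 0)
  have hpA : Module.Projective A P0 := by
    obtain ⟨s, hs⟩ := (Module.projective_def'.1 hp)
    let mF : Module.Free A (P0 →₀ W) := inferInstance
    exact Module.Projective.of_split (M := P0 →₀ W) (s.restrictScalars A)
      ((Finsupp.linearCombination W id).restrictScalars A)
      (by ext x; exact LinearMap.congr_fun hs x)
  have key := aux_glue (C.sc' 0 1 2)
    (T := M →ₗ[A] (F ⧸ LinearMap.range (Algebra.linearMap A F)))
    (fun w t => t ∘ₗ (DistribSMul.toLinearMap A M w))
    (fun (f : P.complex.X 1 ⟶ ModuleCat.of W W) t => auxRel F lam d1 π f.hom t)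
    (fun f hf => auxRel_ex lam d2 d1 π hπ h1 h2 _ (congrArg ModuleCat.Hom.hom hf))
    (fun f t t' => auxRel_uniq lam d1 π hπ h1 htors _ t t')
    (fun f f' t t' => auxRel_add lam d1 π _ _ t t')
    (fun w f t => auxRel_smul lam d1 π w _ t)
    (fun t => by
      obtain ⟨f, hf, hr⟩ := auxRel_surj lam hinj hsur d2 d1 π h1 h2 t
      exact ⟨ModuleCat.ofHom f, ModuleCat.hom_ext hf, hr⟩)
    (fun f => by
      refine (auxRel_ker lam hinj hsur d1 π _).trans ⟨?_, ?_⟩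
      · rintro ⟨h, hh⟩
        exact ⟨ModuleCat.ofHom h, ModuleCat.hom_ext hh⟩
      · rintro ⟨h, hh⟩
        exact ⟨ModuleCat.Hom.hom h, congrArg ModuleCat.Hom.hom hh⟩)
  obtain ⟨e, he⟩ := key
  refine ⟨i1.toLinearEquiv.toAddEquiv.trans e, fun w x => ?_⟩
  have := he w (i1.toLinearEquiv x)
  rw [← map_smul] at this
  exact this

theorem stmt_6 (p : ℕ) [Fact p.Prime] (K : Type) [Field K]
    [Algebra ℚ_[p] K] [FiniteDimensional ℚ_[p] K]
    [Algebra ℤ_[p] K] [IsScalarTower ℤ_[p] ℚ_[p] K]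
    (hloc : IsLocalRing (integralClosure ℤ_[p] K))
    (hunram : @IsLocalRing.maximalIdeal _ _ hloc =
      Ideal.span {(p : integralClosure ℤ_[p] K)})
    (M : Type) [AddCommGroup M] [Module (integralClosure ℤ_[p] K) M]
    [Module ℤ_[p] M] [IsScalarTower ℤ_[p] (integralClosure ℤ_[p] K) M]
    (hM : IsFiniteLength (integralClosure ℤ_[p] K) M) :
    ∃ e : (((Ext (integralClosure ℤ_[p] K)
              (ModuleCat (integralClosure ℤ_[p] K)) 1).obj
            (op (ModuleCat.of (integralClosure ℤ_[p] K) M))).obj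
            (ModuleCat.of (integralClosure ℤ_[p] K) (integralClosure ℤ_[p] K))) ≃+
          (M →ₗ[ℤ_[p]] (ℚ_[p] ⧸ LinearMap.range (Algebra.linearMap ℤ_[p] ℚ_[p]))),
      ∀ (w : integralClosure ℤ_[p] K) (x),
        e (w • x) = (e x) ∘ₗ (DistribMulAction.toLinearMap ℤ_[p] M w) := by
  have hchar : CharZero ℚ_[p] := inferInstance
  have htf : Module.IsTorsionFree ℤ_[p] K := by
    have : FaithfulSMul ℤ_[p] K := (faithfulSMul_iff_algebraMap_injective _ _).2 (by
      rw [IsScalarTower.algebraMap_eq ℤ_[p] ℚ_[p] K]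
      exact (algebraMap ℚ_[p] K).injective.comp (IsFractionRing.injective ℤ_[p] ℚ_[p]))
    infer_instance
  have hfree : Module.Free ℤ_[p] (integralClosure ℤ_[p] K) :=
    IsIntegralClosure.module_free ℤ_[p] ℚ_[p] K _
  have hfin : Module.Finite ℤ_[p] (integralClosure ℤ_[p] K) :=
    IsIntegralClosure.finite ℤ_[p] ℚ_[p] K _
  obtain ⟨lam, hinj, hsur⟩ := aux_lam_exists (A := ℤ_[p]) (W := integralClosure ℤ_[p] K)
    (p : ℤ_[p]) PadicInt.maximalIdeal_eq_span_p (by simpa using hunram)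
  have htors : ∀ m : M, ∃ a : ℤ_[p], a ≠ 0 ∧ a • m = 0 := fun m => by
    obtain ⟨n, hn⟩ := aux_tors (R := integralClosure ℤ_[p] K) (p : integralClosure ℤ_[p] K)
      (by rw [hunram]; exact Ideal.mem_span_singleton_self _) hM m
    refine ⟨(p : ℤ_[p]) ^ n, pow_ne_zero _ (by
      exact_mod_cast (Fact.out : p.Prime).ne_zero), ?_⟩
    rw [← hn, ← algebraMap_smul (integralClosure ℤ_[p] K)]
    simp
  exact aux_main lam hinj hsur htors
end

section
/- Let k be a field, m ≥ 1, and R = k[[x₁,…,x_m]]. For every finite length R-module M, Ext^i_R(M, R) = 0 for all i ≠ m, and there is an isomorphism of R-modules Ext^m_R(M, R) ≅ Hom_k(M, k), where R acts on Hom_k(M, k) through its action on M. -/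
/-!
STATEMENT 10: Let k be a field, m ≥ 1, and R = k[[x₁,…,x_m]].  For every finite length
R-module M, Ext^i_R(M, R) = 0 for all i ≠ m, and there is an isomorphism of R-modules
Ext^m_R(M, R) ≅ Hom_k(M, k), where R acts on Hom_k(M, k) through its action on M.
The latter is expressed as an additive isomorphism intertwining the R-action on Ext
with the action (r·f)(x) = f(r•x) on Hom_k(M, k).
-/

open CategoryTheory Opposite


section Homological
open CategoryTheory.Limits
universe u
variable {R : Type u} [CommRing R]

/-- functoriality of `linearYonedaObj` in the second argument -/
noncomputable def lyMap (P : ChainComplex (ModuleCat.{u} R) ℕ) {A B : ModuleCat.{u} R} (g : A ⟶ B) :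
    P.linearYonedaObj R A ⟶ P.linearYonedaObj R B where
  f i := ((linearYoneda R (ModuleCat.{u} R)).map g).app (op (P.X i))
  comm' i j _ := (((linearYoneda R (ModuleCat.{u} R)).map g).naturality (P.d j i).op).symm

lemma isZero_of_bij {M : ModuleCat.{u} R} (P : ProjectiveResolution M) (N : ModuleCat.{u} R) (y : R)
    (hM : ∀ x : M, y • x = 0) (hN : Function.Bijective (fun x : N => y • x)) (j : ℕ) :
    IsZero ((P.complex.linearYonedaObj R N).homology j) := by
  have hom : Homotopy (y • 𝟙 P.complex) 0 := ProjectiveResolution.liftHomotopyZero _ (by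
    rw [Linear.smul_comp, Category.id_comp]
    ext x
    exact hM _)
  let e : N ≃ₗ[R] N := LinearEquiv.ofBijective (LinearMap.lsmul R N y) hN
  rw [← HomologicalComplex.exactAt_iff_isZero_homology]
  cases j with
  | zero =>
    rw [HomologicalComplex.exactAt_iff' _ 0 0 1 (by simp) (by simp), ShortComplex.moduleCat_exact_iff]
    intro (f : P.complex.X 0 ⟶ N) (hf : P.complex.d 1 0 ≫ f = 0)
    refine ⟨0, ?_⟩
    have h1 := hom.comm 0
    rw [prevD_eq hom.hom (j := 0) (j' := 1) (by simp)] at h1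
    simp at h1
    have h2 : f = (y • 𝟙 _) ≫ f ≫ ModuleCat.ofHom e.symm.toLinearMap := by
      rw [Linear.smul_comp, Category.id_comp]
      ext x
      exact (e.apply_symm_apply (f x)).symm
    have h3 : f = 0 := by
      rw [h2, h1, Category.assoc, reassoc_of% hf, zero_comp, comp_zero]
    rw [h3, map_zero]
    rfl
  | succ j =>
    rw [HomologicalComplex.exactAt_iff' _ j (j+1) (j+2) (by simp) (by simp), ShortComplex.moduleCat_exact_iff]
    intro (f : P.complex.X (j+1) ⟶ N) (hf : P.complex.d (j+2) (j+1) ≫ f = 0)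
    refine ⟨hom.hom j (j+1) ≫ f ≫ ModuleCat.ofHom e.symm.toLinearMap, ?_⟩
    have h1 := hom.comm (j+1)
    rw [dNext_eq hom.hom (i := j+1) (i' := j) (by simp),
      prevD_eq hom.hom (j := j+1) (j' := j+2) (by simp)] at h1
    simp at h1
    have h2 : f = (y • 𝟙 _) ≫ f ≫ ModuleCat.ofHom e.symm.toLinearMap := by
      rw [Linear.smul_comp, Category.id_comp]
      ext x
      exact (e.apply_symm_apply (f x)).symm
    change P.complex.d (j+1) j ≫ hom.hom j (j+1) ≫ f ≫ ModuleCat.ofHom e.symm.toLinearMap = f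
    conv_rhs => rw [h2, h1, Preadditive.add_comp, Category.assoc, Category.assoc, reassoc_of% hf,
      zero_comp, comp_zero, add_zero]

lemma isZero_of_injective {M : ModuleCat.{u} R} (P : ProjectiveResolution M) (E : ModuleCat.{u} R)
    [Injective E] (j : ℕ) :
    IsZero ((P.complex.linearYonedaObj R E).homology (j+1)) := by
  rw [← HomologicalComplex.exactAt_iff_isZero_homology]
  rw [HomologicalComplex.exactAt_iff' _ j (j+1) (j+2) (by simp) (by simp), ShortComplex.moduleCat_exact_iff]
  intro (f : P.complex.X (j+1) ⟶ E) (hf : P.complex.d (j+2) (j+1) ≫ f = 0)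
  exact ⟨(P.exact_succ j).descToInjective f hf, (P.exact_succ j).comp_descToInjective f hf⟩

noncomputable def lyShort (P : ChainComplex (ModuleCat.{u} R) ℕ) (S : ShortComplex (ModuleCat.{u} R)) :
    ShortComplex (CochainComplex (ModuleCat.{u} R) ℕ) where
  X₁ := P.linearYonedaObj R S.X₁
  X₂ := P.linearYonedaObj R S.X₂
  X₃ := P.linearYonedaObj R S.X₃
  f := lyMap P S.f
  g := lyMap P S.g
  zero := by
    ext i (f : P.X i ⟶ S.X₁)
    change (f ≫ S.f) ≫ S.g = 0
    simp

lemma lyShort_exact {M : ModuleCat.{u} R} (P : ProjectiveResolution M)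
    {S : ShortComplex (ModuleCat.{u} R)} (hS : S.ShortExact) : (lyShort P.complex S).ShortExact := by
  refine HomologicalComplex.shortExact_of_degreewise_shortExact _ fun i => ?_
  have := hS.mono_f
  have := hS.epi_g
  refine ModuleCat.shortComplex_shortExact _ ?_ ?_ ?_
  · rw [← ShortComplex.ShortExact.moduleCat_exact_iff_function_exact, ShortComplex.moduleCat_exact_iff]
    intro (f : P.complex.X i ⟶ S.X₂) (hf : f ≫ S.g = 0)
    exact ⟨hS.exact.lift f hf, hS.exact.lift_f f hf⟩
  · intro (f : P.complex.X i ⟶ S.X₁) (f' : P.complex.X i ⟶ S.X₁) (h : f ≫ S.f = f' ≫ S.f)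
    exact (cancel_mono S.f).1 h
  · intro (f : P.complex.X i ⟶ S.X₃)
    exact ⟨Projective.factorThru f S.g, Projective.factorThru_comp f S.g⟩

noncomputable def shiftIso {M : ModuleCat.{u} R} (P : ProjectiveResolution M)
    {S : ShortComplex (ModuleCat.{u} R)} (hS : S.ShortExact) (y : R)
    (hM : ∀ x : M, y • x = 0) (hN : Function.Bijective (fun x : S.X₂ => y • x)) (j : ℕ) :
    (P.complex.linearYonedaObj R S.X₃).homology j ≅ (P.complex.linearYonedaObj R S.X₁).homology (j+1) :=
  (lyShort_exact P hS).δIso j (j+1) (by simp) (isZero_of_bij P _ y hM hN j)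
    (isZero_of_bij P _ y hM hN (j+1))

lemma isZero_H0 {M : ModuleCat.{u} R} (P : ProjectiveResolution M)
    {S : ShortComplex (ModuleCat.{u} R)} (hS : S.ShortExact) (y : R)
    (hM : ∀ x : M, y • x = 0) (hN : Function.Bijective (fun x : S.X₂ => y • x)) :
    IsZero ((P.complex.linearYonedaObj R S.X₁).homology 0) := by
  have h := isZero_of_bij P _ y hM hN 0
  rw [← HomologicalComplex.exactAt_iff_isZero_homology] at h ⊢
  rw [HomologicalComplex.exactAt_iff' _ 0 0 1 (by simp) (by simp), ShortComplex.moduleCat_exact_iff] at h ⊢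
  intro (f : P.complex.X 0 ⟶ S.X₁) (hf : P.complex.d 1 0 ≫ f = 0)
  obtain ⟨g, hg⟩ := h (f ≫ S.f) (by change P.complex.d 1 0 ≫ f ≫ S.f = 0; rw [reassoc_of% hf, zero_comp])
  refine ⟨0, ?_⟩
  have := hS.mono_f
  have h0 : f ≫ S.f = 0 := by
    rw [← hg]
    simp
    rfl
  have h1 : f = 0 := by rw [← cancel_mono S.f, h0, zero_comp]
  rw [h1, map_zero]
  rfl

/-- `H⁰` is `Hom`. -/
lemma exists_H0 {M : ModuleCat.{u} R} (P : ProjectiveResolution M) (N : ModuleCat.{u} R) :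
    Nonempty ((P.complex.linearYonedaObj R N).homology 0 ≃ₗ[R] (M ⟶ N)) := by
  let K := P.complex.linearYonedaObj R N
  have e1 : K.homology 0 ≃ₗ[R] K.cycles 0 := (CochainComplex.isoHomologyπ₀ K).symm.toLinearEquiv
  let φ : (M ⟶ N) →ₗ[R] K.X 0 := Linear.leftComp R N (P.π.f 0 : P.complex.X 0 ⟶ M)
  have hφ : Function.Injective φ := by
    intro f g (h : (P.π.f 0 : P.complex.X 0 ⟶ M) ≫ f = (P.π.f 0 : P.complex.X 0 ⟶ M) ≫ g)
    have : Epi (P.π.f 0 : P.complex.X 0 ⟶ M) := inferInstanceAs (Epi (P.π.f 0))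
    exact (cancel_epi (P.π.f 0 : P.complex.X 0 ⟶ M)).1 h
  let ψ : K.cycles 0 →ₗ[R] K.X 0 := (K.iCycles 0).hom
  have hψ : Function.Injective ψ := (ModuleCat.mono_iff_injective (K.iCycles 0)).1 inferInstance
  have hr : LinearMap.range ψ = LinearMap.range φ := by
    ext (f : P.complex.X 0 ⟶ N)
    have hz : f ∈ LinearMap.range ψ ↔ P.complex.d 1 0 ≫ f = 0 := by
      constructor
      · rintro ⟨z, hz⟩
        have : (K.iCycles 0 ≫ K.d 0 1) z = 0 := by simp
        rw [← hz]
        exact this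
      · intro h
        let t : ModuleCat.of R R ⟶ K.X 0 := ModuleCat.ofHom (LinearMap.toSpanSingleton R _ f)
        have ht : t ≫ K.d 0 1 = 0 := by
          ext
          change P.complex.d 1 0 ≫ ((1 : R) • f) = 0
          rw [one_smul, h]
        refine ⟨K.liftCycles t 1 (by simp) ht 1, ?_⟩
        change (K.liftCycles t 1 _ ht ≫ K.iCycles 0) 1 = f
        rw [HomologicalComplex.liftCycles_i]
        change (1 : R) • f = f
        rw [one_smul]
    refine hz.trans ?_
    constructor
    · intro h
      have : Epi (ShortComplex.mk _ _ P.complex_d_comp_π_f_zero).g := inferInstanceAs (Epi (P.π.f 0))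
      exact ⟨P.exact₀.desc f h, P.exact₀.g_desc f h⟩
    · rintro ⟨g, rfl⟩
      change P.complex.d 1 0 ≫ (P.π.f 0 : P.complex.X 0 ⟶ M) ≫ g = 0
      have := P.complex_d_comp_π_f_zero
      have h2 : P.complex.d 1 0 ≫ (P.π.f 0 : P.complex.X 0 ⟶ M) = 0 := this
      exact (Category.assoc _ _ _).symm.trans ((congrArg (fun t => t ≫ g) h2).trans zero_comp)
  exact ⟨e1 ≪≫ₗ LinearEquiv.ofInjective ψ hψ ≪≫ₗ LinearEquiv.ofEq _ _ hr ≪≫ₗ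
    (LinearEquiv.ofInjective φ hφ).symm⟩

lemma chain_shift {M : ModuleCat.{u} R} (P : ProjectiveResolution M) (m : ℕ) (C : ℕ → ModuleCat.{u} R)
    (h : ∀ i < m, ∃ S : ShortComplex (ModuleCat.{u} R), S.ShortExact ∧ S.X₁ = C i ∧ S.X₃ = C (i+1) ∧
      ∃ y : R, (∀ x : M, y • x = 0) ∧ Function.Bijective (fun x : S.X₂ => y • x)) :
    (∀ i < m, IsZero ((P.complex.linearYonedaObj R (C i)).homology 0)) ∧
    ∀ i ≤ m, ∀ j, Nonempty ((P.complex.linearYonedaObj R (C i)).homology j ≅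
      (P.complex.linearYonedaObj R (C 0)).homology (j + i)) := by
  constructor
  · intro i hi
    obtain ⟨S, hS, h1, h3, y, hy, hb⟩ := h i hi
    rw [← h1]
    exact isZero_H0 P hS y hy hb
  · intro i
    induction i with
    | zero => exact fun _ j => ⟨Iso.refl _⟩
    | succ i ih =>
      intro hi j
      obtain ⟨S, hS, h1, h3, y, hy, hb⟩ := h i hi
      obtain ⟨e⟩ := ih (by omega) (j+1)
      have e' := shiftIso P hS y hy hb j
      rw [h1, h3] at e'
      rw [show j + (i + 1) = j + 1 + i by ring]
      exact ⟨e' ≪≫ e⟩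
/-- multiplication by `y` is bijective -/
def LBij (R : Type u) [CommRing R] (D : Type u) [AddCommGroup D] [Module R D] (y : R) : Prop :=
  Function.Bijective (fun x : D => y • x)

/-- The general vanishing / shifting statement over an arbitrary commutative ring. -/
lemma ext_concl (R : Type u) [CommRing R] (M : Type u) [AddCommGroup M] [Module R M] (m : ℕ)
    (C : ℕ → Type u) [∀ i, AddCommGroup (C i)] [∀ i, Module R (C i)]
    (D : ℕ → Type u) [∀ i, AddCommGroup (D i)] [∀ i, Module R (D i)]
    (f : ∀ i, C i →ₗ[R] D i) (g : ∀ i, D i →ₗ[R] C (i+1))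
    (hf : ∀ i < m, Function.Injective (f i)) (hg : ∀ i < m, Function.Surjective (g i))
    (hfg : ∀ i < m, Function.Exact (f i) (g i))
    (hy : ∀ i < m, ∃ y : R, (∀ x : M, y • x = 0) ∧ LBij R (D i) y)
    (hinj : Module.Injective R (C m)) (e0 : R ≃ₗ[R] C 0) :
    (∀ i : ℕ, i ≠ m →
      Subsingleton (((Ext R (ModuleCat.{u} R) i).obj (op (ModuleCat.of _ M))).obj
        (ModuleCat.of _ R))) ∧
    Nonempty ((((Ext R (ModuleCat.{u} R) m).obj (op (ModuleCat.of _ M))).obj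
        (ModuleCat.of _ R)) ≃ₗ[R] (M →ₗ[R] C m)) := by
  let C' : ℕ → ModuleCat.{u} R := fun i => ModuleCat.of R (C i)
  let P := ProjectiveResolution.of (ModuleCat.of R M)
  have hchain := chain_shift P m C' (by
    intro i hi
    obtain ⟨y, hy1, hy2⟩ := hy i hi
    refine ⟨ShortComplex.mk (ModuleCat.ofHom (f i)) (ModuleCat.ofHom (g i)) ?_, ?_, rfl, rfl,
      y, hy1, hy2⟩
    · ext x
      exact (hfg i hi).apply_apply_eq_zero x
    · exact ModuleCat.shortComplex_shortExact _ (hfg i hi) (hf i hi) (hg i hi))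
  obtain ⟨hz, hs⟩ := hchain
  have hinj' : Injective (C' m) := Module.injective_object_of_injective_module _ _
  have iso0 : ∀ j, Nonempty ((((Ext R (ModuleCat.{u} R) j).obj
        (op (ModuleCat.of _ M))).obj (ModuleCat.of _ R)) ≅
        (P.complex.linearYonedaObj R (C' 0)).homology j) := fun j =>
    ⟨((Ext R (ModuleCat.{u} R) j).obj (op (ModuleCat.of _ M))).mapIso
        e0.toModuleIso ≪≫ P.isoExt j (C' 0)⟩
  constructor
  · intro i hi
    apply ModuleCat.subsingleton_of_isZero
    obtain ⟨e⟩ := iso0 i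
    refine Limits.IsZero.of_iso ?_ e
    rcases lt_or_gt_of_ne hi with h | h
    · obtain ⟨e'⟩ := hs i h.le 0
      rw [zero_add] at e'
      exact (hz i h).of_iso e'.symm
    · obtain ⟨j, rfl⟩ := Nat.exists_eq_add_of_lt h
      obtain ⟨e'⟩ := hs m le_rfl (j+1)
      rw [show m + j + 1 = j + 1 + m by ring]
      exact (isZero_of_injective P (C' m) j).of_iso e'.symm
  · obtain ⟨e⟩ := iso0 m
    obtain ⟨e'⟩ := hs m le_rfl 0
    rw [zero_add] at e'
    obtain ⟨e2⟩ := exists_H0 P (C' m)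
    exact ⟨(e ≪≫ e'.symm).toLinearEquiv ≪≫ₗ e2 ≪≫ₗ ModuleCat.homLinearEquiv⟩
end Homological

section Matlis
variable {k R E : Type} [Field k] [CommRing R] [Algebra k R] [AddCommGroup E] [Module R E]
  (I0 : Ideal R) (ρ : E →+ k)

lemma matlis_baer [IsNoetherianRing R]
    (hk : ∀ (c : k) (e : E), ρ (algebraMap k R c • e) = c * ρ e)
    (h1 : ∀ e : E, (∀ r : R, ρ (r • e) = 0) → e = 0)
    (h2 : ∀ e : E, ∃ N : ℕ, ∀ r ∈ I0 ^ N, r • e = 0)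
    (h3 : ∀ (N : ℕ) (l : R →ₗ[k] k), (∀ r ∈ I0 ^ N, l r = 0) → ∃ e : E, ∀ r, ρ (r • e) = l r) :
    Module.Injective R E := by
  apply Module.Baer.injective
  intro I g
  -- uniform annihilation
  have hN : ∃ N : ℕ, ∀ r ∈ I0 ^ N, ∀ x : I, r • g x = 0 := by
    obtain ⟨s, hs⟩ := (inferInstance : Module.Finite R I).fg_top
    choose n hn using h2
    refine ⟨s.sup (fun x => n (g x)), fun r hr x => ?_⟩
    have : (⊤ : Submodule R I) ≤ LinearMap.ker (r • g) := by
      rw [← hs, Submodule.span_le]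
      intro y hy
      exact hn (g y) r (Ideal.pow_le_pow_right (Finset.le_sup (f := fun x => n (g x)) hy) hr)
    exact this (x := x) trivial
  obtain ⟨N, hN⟩ := hN
  obtain ⟨K, hK⟩ := Ideal.exists_pow_inf_eq_pow_smul I0 I
  have hzero : ∀ x : I, (x : R) ∈ I0 ^ (N + K) → g x = 0 := by
    intro x hx
    have hx' : (x : R) ∈ I0 ^ N • (I0 ^ K • ⊤ ⊓ I : Submodule R R) := by
      have := hK (N + K) (by omega)
      rw [Nat.add_sub_cancel] at this
      rw [← this]
      refine ⟨?_, x.2⟩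
      simpa using hx
    have key : I0 ^ N • (I0 ^ K • ⊤ ⊓ I : Submodule R R) ≤ (LinearMap.ker g).map I.subtype := by
      rw [Submodule.smul_le]
      intro r hr n hn
      refine ⟨r • ⟨n, hn.2⟩, ?_, rfl⟩
      change g _ = 0
      rw [map_smul]
      exact hN r hr _
    obtain ⟨z, hz, hzx⟩ := key hx'
    obtain rfl : z = x := Subtype.ext hzx
    exact hz
  let u : I →ₗ[k] (R ⧸ (I0 ^ (N + K)).restrictScalars k) :=
    ((I0 ^ (N + K)).restrictScalars k).mkQ ∘ₗ (I.restrictScalars k).subtype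
  let v : I →ₗ[k] k :=
    { toFun := fun x => ρ (g x)
      map_add' := by simp
      map_smul' := fun c x => by
        rw [← algebraMap_smul R c x, map_smul, hk]; rfl }
  have hv : v ∈ LinearMap.range u.dualMap := by
    rw [LinearMap.range_dualMap_eq_dualAnnihilator_ker, Submodule.mem_dualAnnihilator]
    intro x hx
    have : (x : R) ∈ I0 ^ (N + K) := by
      have : ((I0 ^ (N + K)).restrictScalars k).mkQ x = 0 := hx
      simpa using this
    change ρ (g x) = 0
    rw [hzero x this, map_zero]
  obtain ⟨l, hl⟩ := hv
  obtain ⟨e, he⟩ := h3 (N + K) (l ∘ₗ ((I0 ^ (N + K)).restrictScalars k).mkQ) (by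
    intro r hr
    have : ((I0 ^ (N + K)).restrictScalars k).mkQ r = 0 := by simpa using hr
    rw [LinearMap.comp_apply, this, map_zero])
  refine ⟨LinearMap.toSpanSingleton R E e, fun x hx => ?_⟩
  rw [← sub_eq_zero]
  apply h1
  intro r
  rw [smul_sub, map_sub, ← map_smul g, LinearMap.toSpanSingleton_apply, ← mul_smul, he, sub_eq_zero]
  exact LinearMap.congr_fun hl ⟨r * x, I.mul_mem_left r hx⟩

lemma matlis_hom
    (hk : ∀ (c : k) (e : E), ρ (algebraMap k R c • e) = c * ρ e)
    (h1 : ∀ e : E, (∀ r : R, ρ (r • e) = 0) → e = 0)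
    (h3 : ∀ (N : ℕ) (l : R →ₗ[k] k), (∀ r ∈ I0 ^ N, l r = 0) → ∃ e : E, ∀ r, ρ (r • e) = l r)
    (M : Type) [AddCommGroup M] [Module R M] [Module k M] [IsScalarTower k R M] (N : ℕ)
    (hM : ∀ r ∈ I0 ^ N, ∀ x : M, r • x = 0) :
    ∃ e : (M →ₗ[R] E) ≃+ (M →ₗ[k] k), ∀ (f : M →ₗ[R] E) x, e f x = ρ (f x) := by
  let F : (M →ₗ[R] E) →+ (M →ₗ[k] k) :=
    { toFun := fun f =>
      { toFun := fun x => ρ (f x)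
        map_add' := by simp
        map_smul' := fun c x => by
          rw [← algebraMap_smul R c x, map_smul, hk]; rfl }
      map_zero' := by ext; simp
      map_add' := fun f g => by ext; simp }
  have hF : ∀ f x, F f x = ρ (f x) := fun f x => rfl
  refine ⟨AddEquiv.ofBijective F ⟨?_, ?_⟩, hF⟩
  · rw [injective_iff_map_eq_zero]
    intro f hf
    ext x
    apply h1
    intro r
    rw [← map_smul, ← hF, hf]; rfl
  · intro l
    have ex : ∀ x : M, ∃ e : E, ∀ r, ρ (r • e) = l (r • x) := fun x =>
      h3 N (l ∘ₗ (LinearMap.toSpanSingleton R M x).restrictScalars k) (fun r hr => by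
        simp [hM r hr x])
    choose e he using ex
    refine ⟨{ toFun := e, map_add' := ?_, map_smul' := ?_ }, ?_⟩
    · intro x y
      rw [← sub_eq_zero]
      apply h1
      intro r
      simp [smul_sub, smul_add, he]
    · intro s x
      rw [← sub_eq_zero]
      apply h1
      intro r
      simp [smul_sub, smul_smul, he]
    · ext x
      rw [hF]
      simpa using he x 1
end Matlis

/-- `I ^ n` kills a finite length module when `I` is in the Jacobson radical. -/
lemma exists_pow_kills {R : Type} [CommRing R] (I0 : Ideal R) (hI : I0 ≤ (⊥ : Ideal R).jacobson)
    (M : Type) [AddCommGroup M] [Module R M] (hM : IsFiniteLength R M) :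
    ∃ N : ℕ, ∀ r ∈ I0 ^ N, ∀ x : M, r • x = 0 := by
  rw [isFiniteLength_iff_isNoetherian_isArtinian] at hM
  obtain ⟨_, _⟩ := hM
  obtain ⟨n, hn⟩ := IsArtinian.monotone_stabilizes (R := R) (M := M)
    ⟨fun n => OrderDual.toDual (I0 ^ n • (⊤ : Submodule R M)), fun a b hab =>
      Submodule.smul_mono_left (Ideal.pow_le_pow_right hab)⟩
  have h := hn (n+1) (by omega)
  have h' : I0 ^ n • (⊤ : Submodule R M) = I0 ^ (n+1) • (⊤ : Submodule R M) := h
  have h0 : I0 ^ n • (⊤ : Submodule R M) = ⊥ := by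
    refine Submodule.eq_bot_of_le_smul_of_le_jacobson_bot I0 _ (IsNoetherian.noetherian _) ?_ hI
    conv_lhs => rw [h', pow_succ', ← smul_eq_mul, Submodule.smul_assoc]
  refine ⟨n, fun r hr x => ?_⟩
  have : r • x ∈ I0 ^ n • (⊤ : Submodule R M) := Submodule.smul_mem_smul hr trivial
  rw [h0] at this
  simpa using this

section Laurent
variable (m : ℕ) (k : Type) [Field k]

/-- exponents -/
def expHom : (Fin m →₀ ℕ) →+ (Fin m → ℤ) where
  toFun n := fun i => (n i : ℤ)
  map_zero' := by ext; simp
  map_add' a b := by ext; simp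

lemma expHom_apply (n : Fin m →₀ ℕ) (i : Fin m) : expHom m n i = (n i : ℤ) := rfl

lemma expHom_inj : Function.Injective (expHom m) := by
  intro a b h
  ext i
  have := congrFun h i
  simpa [expHom_apply] using this

/-- Laurent series with exponents bounded below -/
def LS := HahnSeries (Fin m → ℤ) k

noncomputable instance : CommRing (LS m k) := inferInstanceAs (CommRing (HahnSeries (Fin m → ℤ) k))

/-- the embedding of power series -/
noncomputable def lsEmb : MvPowerSeries (Fin m) k →+* LS m k :=
  (HahnSeries.embDomainRingHom (expHom m) (expHom_inj m) (by
    intro g g'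
    simp [Pi.le_def, expHom_apply, Finsupp.le_def])).comp
    (HahnSeries.toMvPowerSeries (σ := Fin m) (R := k)).symm.toRingHom

noncomputable instance : Algebra (MvPowerSeries (Fin m) k) (LS m k) := (lsEmb m k).toAlgebra

variable {m k}

lemma ls_smul_def (r : MvPowerSeries (Fin m) k) (f : LS m k) : r • f = lsEmb m k r * f := rfl

/-- coefficient -/
def cf (a : Fin m → ℤ) : LS m k →+ k where
  toFun f := HahnSeries.coeff f a
  map_zero' := rfl
  map_add' _ _ := rfl

lemma ls_ext {f g : LS m k} (h : ∀ a, cf a f = cf a g) : f = g :=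
  HahnSeries.ext (funext h)

lemma cf_emb (r : MvPowerSeries (Fin m) k) (n : Fin m →₀ ℕ) :
    cf (expHom m n) (lsEmb m k r) = MvPowerSeries.coeff n r :=
  HahnSeries.embDomain_coeff

lemma cf_emb_zero (r : MvPowerSeries (Fin m) k) (a : Fin m → ℤ) (h : cf a (lsEmb m k r) ≠ 0) :
    ∃ n, expHom m n = a := by
  by_contra hc
  exact h (HahnSeries.embDomain_of_notMem_range (fun hx => hc hx))

lemma exp_of_nonneg (a : Fin m → ℤ) (h : ∀ i, 0 ≤ a i) : ∃ n, expHom m n = a := by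
  refine ⟨Finsupp.equivFunOnFinite.symm (fun i => (a i).toNat), ?_⟩
  ext i
  simp [expHom_apply, h i]

lemma cf_smul_ne (r : MvPowerSeries (Fin m) k) (f : LS m k) (a : Fin m → ℤ)
    (h : cf a (r • f) ≠ 0) : ∃ b, b ≤ a ∧ cf b f ≠ 0 := by
  obtain ⟨x, hx, y, hy, rfl⟩ := Set.mem_add.1 (HahnSeries.support_mul_subset (show a ∈ HahnSeries.support (_ * _) from h))
  refine ⟨y, ?_, hy⟩
  obtain ⟨n, rfl⟩ := cf_emb_zero r x hx
  intro i
  simp [expHom_apply]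

/-- monomials -/
noncomputable def mono (b : Fin m → ℤ) (c : k) : LS m k := HahnSeries.single b c

lemma cf_mono_mul (b : Fin m → ℤ) (c : k) (f : LS m k) (a : Fin m → ℤ) :
    cf a (mono b c * f) = c * cf (a - b) f := HahnSeries.coeff_single_mul

lemma cf_mul_mono (b : Fin m → ℤ) (c : k) (f : LS m k) (a : Fin m → ℤ) :
    cf a (f * mono b c) = cf (a - b) f * c := HahnSeries.coeff_mul_single

lemma emb_monomial (n : Fin m →₀ ℕ) (c : k) :
    lsEmb m k (MvPowerSeries.monomial n c) = mono (expHom m n) c := by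
  apply ls_ext
  intro a
  classical
  by_cases h : a = expHom m n
  · rw [h, cf_emb, MvPowerSeries.coeff_monomial_same]
    exact (HahnSeries.coeff_single_same _ _).symm
  · have h1 : cf a (mono (expHom m n) c) = 0 := HahnSeries.coeff_single_of_ne h
    rw [h1]
    by_contra hc
    obtain ⟨n', rfl⟩ := cf_emb_zero _ _ hc
    rw [cf_emb, MvPowerSeries.coeff_monomial_ne] at hc
    · exact hc rfl
    · rintro rfl; exact h rfl

lemma cf_monomial_smul (n : Fin m →₀ ℕ) (c : k) (f : LS m k) (a : Fin m → ℤ) :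
    cf a (MvPowerSeries.monomial n c • f) = c * cf (a - expHom m n) f := by
  rw [ls_smul_def, emb_monomial, cf_mono_mul]

lemma cf_X_pow_smul (i : Fin m) (N : ℕ) (f : LS m k) (a : Fin m → ℤ) :
    cf a ((MvPowerSeries.X i ^ N : MvPowerSeries (Fin m) k) • f) = cf (a - Pi.single i (N : ℤ)) f := by
  rw [MvPowerSeries.X_pow_eq, cf_monomial_smul, one_mul]
  congr 3
  ext j
  simp [expHom_apply, Finsupp.single_apply, Pi.single_apply, eq_comm]

open Classical in
/-- restriction of the support -/
noncomputable def res (S : Set (Fin m → ℤ)) (f : LS m k) : LS m k :=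
  ⟨fun a => if a ∈ S then cf a f else 0, (HahnSeries.isPWO_support f).mono (by
    intro a ha
    by_contra hc
    have : cf a f = 0 := by_contra fun h => hc h
    simp [this] at ha)⟩

open Classical in
lemma cf_res (S : Set (Fin m → ℤ)) (f : LS m k) (a : Fin m → ℤ) :
    cf a (res S f) = if a ∈ S then cf a f else 0 := rfl

/-- support in `S` -/
def LSub (S : Set (Fin m → ℤ)) (hS : IsUpperSet S) : Submodule (MvPowerSeries (Fin m) k) (LS m k) where
  carrier := {f | ∀ a, cf a f ≠ 0 → a ∈ S}
  zero_mem' := by intro a h; simp at h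
  add_mem' := by
    intro f g hf hg a h
    by_contra hc
    rw [map_add, not_imp_comm.1 (hf a) hc, not_imp_comm.1 (hg a) hc, add_zero] at h
    exact h rfl
  smul_mem' := by
    intro r f hf a h
    obtain ⟨b, hb, hb'⟩ := cf_smul_ne r f a h
    exact hS hb (hf b hb')

lemma mem_LSub {S : Set (Fin m → ℤ)} {hS : IsUpperSet S} {f : LS m k} :
    f ∈ LSub S hS ↔ ∀ a, cf a f ≠ 0 → a ∈ S := Iff.rfl

/-- bounded below -/
lemma exists_bound (f : LS m k) : ∃ N : ℕ, ∀ a, cf a f ≠ 0 → ∀ i, -(N : ℤ) ≤ a i := by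
  have hp : (HahnSeries.support f).IsPWO := HahnSeries.isPWO_support f
  have h : ∀ i : Fin m, ∃ N : ℕ, ∀ a, cf a f ≠ 0 → -(N : ℤ) ≤ a i := by
    intro i
    have h1 : ((fun a : Fin m → ℤ => a i) '' (HahnSeries.support f)).IsPWO :=
      hp.image_of_monotone (fun a b hab => hab i)
    by_cases hne : ((fun a : Fin m → ℤ => a i) '' (HahnSeries.support f)).Nonempty
    · refine ⟨(h1.isWF.min hne).natAbs, fun a ha => ?_⟩
      have : h1.isWF.min hne ≤ a i :=
        h1.isWF.min_le hne (Set.mem_image_of_mem (fun a : Fin m → ℤ => a i) ha)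
      omega
    · exact ⟨0, fun a ha => absurd ⟨_, Set.mem_image_of_mem _ ha⟩ hne⟩
  choose N hN using h
  refine ⟨Finset.univ.sup N, fun a ha i => ?_⟩
  have := hN i a ha
  have h2 : N i ≤ Finset.univ.sup N := Finset.le_sup (Finset.mem_univ i)
  omega

end Laurent

section Quot
variable {R X : Type} [CommRing R] [AddCommGroup X] [Module R X]

/-- subquotient -/
abbrev SQ (U V : Submodule R X) := U ⧸ V.submoduleOf U

instance sqAddCommGroup (U V : Submodule R X) : AddCommGroup (SQ U V) :=
  Submodule.Quotient.addCommGroup _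
instance sqModule (U V : Submodule R X) : Module R (SQ U V) :=
  Submodule.Quotient.module _

noncomputable def sqMap {U V W V2 : Submodule R X} (h : U ≤ W) (h' : V ≤ V2) : SQ U V →ₗ[R] SQ W V2 :=
  Submodule.mapQ _ _ (Submodule.inclusion h) (by
    intro x hx
    exact h' hx)

lemma sqMap_mk_eq_zero {U V W V2 : Submodule R X} (h : U ≤ W) (h' : V ≤ V2) (x : U) :
    sqMap h h' (Submodule.Quotient.mk x) = 0 ↔ (x : X) ∈ V2 :=
  Submodule.Quotient.mk_eq_zero (V2.submoduleOf W) (x := Submodule.inclusion h x)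

lemma sqMap_mk {U V W V2 : Submodule R X} (h : U ≤ W) (h' : V ≤ V2) (x : U) :
    sqMap h h' (Submodule.Quotient.mk x) = Submodule.Quotient.mk (Submodule.inclusion h x) := rfl

lemma sq_inj {U V W : Submodule R X} (h : U ≤ W) :
    Function.Injective (sqMap h (le_refl V)) := by
  rw [injective_iff_map_eq_zero]
  intro x
  induction x using Submodule.Quotient.induction_on with
  | H x =>
    intro hx
    rw [sqMap_mk_eq_zero] at hx
    rw [Submodule.Quotient.mk_eq_zero]
    exact hx

lemma sq_surj {W V V2 : Submodule R X} (h : V ≤ V2) :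
    Function.Surjective (sqMap (le_refl W) h) := by
  intro x
  induction x using Submodule.Quotient.induction_on with
  | H x => exact ⟨Submodule.Quotient.mk x, rfl⟩

lemma sq_exact {U W V V2 : Submodule R X} (hU : U ≤ W) (hV : V ≤ V2) (h1 : U ≤ V2) (h2 : W ⊓ V2 ≤ U ⊔ V) :
    Function.Exact (sqMap hU (le_refl V)) (sqMap (le_refl W) hV) := by
  intro x
  induction x using Submodule.Quotient.induction_on with
  | H x =>
    constructor
    · intro hx
      rw [sqMap_mk_eq_zero] at hx
      obtain ⟨u, hu, v, hv, huv⟩ := Submodule.mem_sup.1 (h2 ⟨x.2, hx⟩)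
      refine ⟨Submodule.Quotient.mk ⟨u, hu⟩, ?_⟩
      rw [sqMap_mk]
      refine (Submodule.Quotient.eq _).2 ?_
      change u - (x : X) ∈ V
      rw [← huv]
      simpa using hv
    · rintro ⟨y, hy⟩
      rw [← hy]
      induction y using Submodule.Quotient.induction_on with
      | H y =>
        rw [sqMap_mk, sqMap_mk_eq_zero]
        exact h1 y.2

lemma sq_bij {W V : Submodule R X} (y : R) (σ : X → X) (h1 : ∀ f, σ (y • f) = f) (h2 : ∀ f, y • σ f = f)
    (hW : ∀ f ∈ W, σ f ∈ W) (hV : ∀ f ∈ V, σ f ∈ V) : LBij R (SQ W V) y := by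
  constructor
  · change Function.Injective (LinearMap.lsmul R (SQ W V) y)
    rw [injective_iff_map_eq_zero]
    intro x
    induction x using Submodule.Quotient.induction_on with
    | H x =>
      intro hx
      rw [LinearMap.lsmul_apply, ← Submodule.Quotient.mk_smul, Submodule.Quotient.mk_eq_zero] at hx
      rw [Submodule.Quotient.mk_eq_zero]
      have := hV _ hx
      change σ (y • (x : X)) ∈ V at this
      rw [h1] at this
      exact this
  · intro x
    induction x using Submodule.Quotient.induction_on with
    | H x =>
      refine ⟨Submodule.Quotient.mk ⟨σ x, hW _ x.2⟩, ?_⟩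
      change y • (Submodule.Quotient.mk ⟨σ x, hW _ x.2⟩ : SQ W V) = _
      rw [← Submodule.Quotient.mk_smul]
      congr 1
      exact Subtype.ext (h2 _)
end Quot

section Chain
variable {m : ℕ} {k : Type} [Field k]

def Sset (m i : ℕ) : Set (Fin m → ℤ) := {a | ∀ j : Fin m, i ≤ j.val → 0 ≤ a j}
def Vset (m i : ℕ) : Set (Fin m → ℤ) := {a | ∃ j : Fin m, j.val < i ∧ 0 ≤ a j}

lemma Sset_upper (m i : ℕ) : IsUpperSet (Sset m i) :=
  fun _ _ hab ha j hj => (ha j hj).trans (hab j)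

lemma Vset_upper (m i : ℕ) : IsUpperSet (Vset m i) :=
  fun _ _ hab ⟨j, hj, h⟩ => ⟨j, hj, h.trans (hab j)⟩

variable (k) in
def SS (m i : ℕ) : Submodule (MvPowerSeries (Fin m) k) (LS m k) := LSub (Sset m i) (Sset_upper m i)
variable (k) in
def VV (m i : ℕ) : Submodule (MvPowerSeries (Fin m) k) (LS m k) := LSub (Vset m i) (Vset_upper m i)

lemma mem_SS {i : ℕ} {f : LS m k} : f ∈ SS k m i ↔ ∀ a, cf a f ≠ 0 → a ∈ Sset m i := Iff.rfl
lemma mem_VV {i : ℕ} {f : LS m k} : f ∈ VV k m i ↔ ∀ a, cf a f ≠ 0 → a ∈ Vset m i := Iff.rfl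

lemma SS_le (i : ℕ) : SS k m i ≤ SS k m (i+1) :=
  fun _ hf a ha j hj => hf a ha j (by omega)

lemma VV_le (i : ℕ) : VV k m i ≤ VV k m (i+1) :=
  fun _ hf a ha => let ⟨j, hj, h⟩ := hf a ha; ⟨j, by omega, h⟩

lemma SS_le_VV (i : ℕ) (hi : i < m) : SS k m i ≤ VV k m (i+1) :=
  fun _ hf a ha => ⟨⟨i, hi⟩, by simp, hf a ha ⟨i, hi⟩ le_rfl⟩

lemma SS_inf_VV (i : ℕ) (hi : i < m) : SS k m (i+1) ⊓ VV k m (i+1) ≤ SS k m i ⊔ VV k m i := by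
  classical
  rintro f ⟨hf1, hf2⟩
  refine Submodule.mem_sup.2 ⟨res {a | 0 ≤ a ⟨i, hi⟩} f, ?_, res {a | ¬ 0 ≤ a ⟨i, hi⟩} f, ?_, ?_⟩
  · rw [mem_SS]
    intro a ha j hj
    rw [cf_res] at ha
    simp only [Set.mem_ofPred_eq, ne_eq, ite_eq_right_iff, Classical.not_imp] at ha
    by_cases h : j.val = i
    · obtain rfl : j = ⟨i, hi⟩ := Fin.ext h
      exact ha.1
    · exact hf1 a ha.2 j (by omega)
  · rw [mem_VV]
    intro a ha
    rw [cf_res] at ha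
    simp only [Set.mem_ofPred_eq, ne_eq, ite_eq_right_iff, Classical.not_imp] at ha
    obtain ⟨j, hj, h⟩ := hf2 a ha.2
    refine ⟨j, ?_, h⟩
    by_contra hc
    obtain rfl : j = ⟨i, hi⟩ := Fin.ext (by simp; omega)
    exact ha.1 h
  · apply ls_ext
    intro a
    rw [map_add, cf_res, cf_res]
    by_cases h : 0 ≤ a ⟨i, hi⟩ <;> simp [h]

lemma chain_bij (i : ℕ) (hi : i < m) (N : ℕ) :
    LBij (MvPowerSeries (Fin m) k) (SQ (SS k m (i+1)) (VV k m i))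
      (MvPowerSeries.X ⟨i, hi⟩ ^ N) := by
  refine sq_bij _ (fun f => mono (-Pi.single ⟨i, hi⟩ (N : ℤ)) 1 * f) ?_ ?_ ?_ ?_
  · intro f
    apply ls_ext
    intro a
    rw [cf_mono_mul, cf_X_pow_smul]
    simp
  · intro f
    apply ls_ext
    intro a
    rw [cf_X_pow_smul, cf_mono_mul]
    simp
  · intro f hf
    rw [mem_SS] at hf ⊢
    intro a ha j hj
    rw [cf_mono_mul, one_mul] at ha
    have := hf _ ha j hj
    have hne : j ≠ ⟨i, hi⟩ := by rintro rfl; simp at hj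
    simpa [hne] using this
  · intro f hf
    rw [mem_VV] at hf ⊢
    intro a ha
    rw [cf_mono_mul, one_mul] at ha
    obtain ⟨j, hj, h⟩ := hf _ ha
    have hne : j ≠ ⟨i, hi⟩ := by rintro rfl; simp at hj
    exact ⟨j, hj, by simpa [hne] using h⟩

lemma chain_zero : Nonempty (MvPowerSeries (Fin m) k ≃ₗ[MvPowerSeries (Fin m) k]
    SQ (SS k m 0) (VV k m 0)) := by
  have hmem : ∀ r : MvPowerSeries (Fin m) k, lsEmb m k r ∈ SS k m 0 := by
    intro r a ha j hj
    obtain ⟨n, rfl⟩ := cf_emb_zero r a ha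
    simp [expHom_apply]
  let φ : MvPowerSeries (Fin m) k →ₗ[MvPowerSeries (Fin m) k] SS k m 0 :=
    { toFun := fun r => ⟨lsEmb m k r, hmem r⟩
      map_add' := fun a b => Subtype.ext (map_add (lsEmb m k) a b)
      map_smul' := fun a b => Subtype.ext (map_mul (lsEmb m k) a b) }
  have hinj : Function.Injective (((VV k m 0).submoduleOf (SS k m 0)).mkQ ∘ₗ φ) := by
    rw [injective_iff_map_eq_zero]
    intro r hr
    rw [LinearMap.comp_apply, Submodule.mkQ_apply, Submodule.Quotient.mk_eq_zero] at hr
    ext n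
    have h2 : lsEmb m k r ∈ VV k m 0 := hr
    by_contra hc
    rw [← cf_emb] at hc
    obtain ⟨j, hj, _⟩ := h2 _ hc
    omega
  have hsurj : Function.Surjective φ := by
    rintro ⟨f, hf⟩
    refine ⟨fun n => cf (expHom m n) f, Subtype.ext (ls_ext fun a => ?_)⟩
    change cf a (lsEmb m k _) = cf a f
    by_cases ha : ∀ i, 0 ≤ a i
    · obtain ⟨n, rfl⟩ := exp_of_nonneg a ha
      exact cf_emb _ n
    · have h1 : cf a f = 0 := by
        by_contra hc
        exact ha fun i => hf a hc i (Nat.zero_le _)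
      rw [h1]
      by_contra hc
      obtain ⟨n, rfl⟩ := cf_emb_zero _ _ hc
      exact ha fun i => by simp [expHom_apply]
  exact ⟨LinearEquiv.ofBijective _ ⟨hinj, (Submodule.mkQ_surjective _).comp hsurj⟩⟩

variable (m k) in
/-- residue -/
noncomputable def resid : SQ (SS k m m) (VV k m m) →+ k :=
  QuotientAddGroup.lift ((VV k m m).submoduleOf (SS k m m)).toAddSubgroup
    ((cf (fun _ => -1)).comp (SS k m m).subtype.toAddMonoidHom) (by
      intro x hx
      have hx' : (x : LS m k) ∈ VV k m m := hx
      change cf _ (x : LS m k) = 0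
      by_contra hc
      obtain ⟨j, _, h⟩ := hx' _ hc
      simp at h)

lemma resid_mk (x : SS k m m) : resid m k (Submodule.Quotient.mk x) = cf (fun _ => -1) (x : LS m k) := rfl

lemma resid_smul_mk (r : MvPowerSeries (Fin m) k) (x : SS k m m) :
    resid m k (r • Submodule.Quotient.mk x) = cf (fun _ => -1) (r • (x : LS m k)) := rfl

lemma mem_SS_top (f : LS m k) : f ∈ SS k m m := fun a _ j hj => absurd j.2 (by omega)

lemma resid_k (c : k) (e : SQ (SS k m m) (VV k m m)) :
    resid m k (algebraMap k (MvPowerSeries (Fin m) k) c • e) = c * resid m k e := by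
  induction e using Submodule.Quotient.induction_on with
  | H x =>
    rw [resid_smul_mk, resid_mk]
    have : algebraMap k (MvPowerSeries (Fin m) k) c = MvPowerSeries.monomial 0 c := rfl
    rw [this, cf_monomial_smul, map_zero, sub_zero]

lemma resid_nondeg (e : SQ (SS k m m) (VV k m m))
    (h : ∀ r : MvPowerSeries (Fin m) k, resid m k (r • e) = 0) : e = 0 := by
  induction e using Submodule.Quotient.induction_on with
  | H x =>
    rw [Submodule.Quotient.mk_eq_zero]
    change (x : LS m k) ∈ VV k m m
    rw [mem_VV]
    intro a ha
    by_contra hc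
    have hneg : ∀ i, a i < 0 := by
      intro i
      by_contra hi
      exact hc ⟨i, i.2, by omega⟩
    obtain ⟨n, hn⟩ := exp_of_nonneg (fun i => -1 - a i) (fun i => by have := hneg i; omega)
    have := h (MvPowerSeries.monomial n 1)
    rw [resid_smul_mk, cf_monomial_smul, hn, one_mul] at this
    apply ha
    rw [← this]
    congr 2
    ext i
    simp

variable (m k) in
/-- the maximal ideal -/
noncomputable def mI : Ideal (MvPowerSeries (Fin m) k) := Ideal.span (Set.range MvPowerSeries.X)

lemma tors_abs {R E ι : Type*} [CommRing R] [IsNoetherianRing R] [AddCommGroup E] [Module R E]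
    (X : ι → R) (e : E) (h : ∀ i, ∃ N : ℕ, X i ^ N • e = 0) :
    ∃ N : ℕ, ∀ r ∈ Ideal.span (Set.range X) ^ N, r • e = 0 := by
  let J : Ideal R := LinearMap.ker (LinearMap.toSpanSingleton R E e)
  have hJ : Ideal.span (Set.range X) ≤ J.radical := by
    rw [Ideal.span_le]
    rintro _ ⟨i, rfl⟩
    obtain ⟨N, hN⟩ := h i
    exact ⟨N, hN⟩
  obtain ⟨N, hN⟩ := Ideal.exists_pow_le_of_le_radical_of_fg hJ (IsNoetherian.noetherian _)
  exact ⟨N, fun r hr => hN hr⟩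

lemma X_tors (x : SS k m m) (i : Fin m) : ∃ N : ℕ, (MvPowerSeries.X i : MvPowerSeries (Fin m) k) ^ N • x ∈
    (VV k m m).submoduleOf (SS k m m) := by
  obtain ⟨N, hN⟩ := exists_bound (x : LS m k)
  refine ⟨N, ?_⟩
  rw [Submodule.submoduleOf, Submodule.mem_comap, Submodule.subtype_apply, Submodule.coe_smul, mem_VV]
  intro a ha
  rw [cf_X_pow_smul] at ha
  have := hN _ ha i
  refine ⟨i, i.2, ?_⟩
  simp at this
  omega

lemma mI_tors (e : SQ (SS k m m) (VV k m m)) :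
    ∃ N : ℕ, ∀ r ∈ mI m k ^ N, r • e = 0 := by
  obtain ⟨x, rfl⟩ := Submodule.Quotient.mk_surjective _ e
  refine tors_abs _ _ fun i => ?_
  obtain ⟨N, hN⟩ := X_tors x i
  refine ⟨N, ?_⟩
  rw [← Submodule.Quotient.mk_smul, Submodule.Quotient.mk_eq_zero]
  exact hN

lemma mem_mI_pow (K : ℕ) (s : Finset (Fin m)) : ∀ r : MvPowerSeries (Fin m) k,
    (∀ n : Fin m →₀ ℕ, (∀ i ∈ s, n i < K) → MvPowerSeries.coeff n r = 0) → r ∈ mI m k ^ K := by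
  classical
  induction s using Finset.induction_on with
  | empty =>
    intro r hr
    have : r = 0 := by ext n; exact hr n (by simp)
    rw [this]; exact Submodule.zero_mem _
  | insert i s his ih =>
    intro r hr
    let r1 : MvPowerSeries (Fin m) k := fun n => if n i < K then 0 else MvPowerSeries.coeff n r
    have c1 : ∀ n, MvPowerSeries.coeff n r1 = if n i < K then 0 else MvPowerSeries.coeff n r := fun n => rfl
    have h1 : r1 ∈ mI m k ^ K := by
      have hd : (MvPowerSeries.X i : MvPowerSeries (Fin m) k) ^ K ∣ r1 := by
        rw [MvPowerSeries.X_pow_dvd_iff]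
        intro n hn
        rw [c1, if_pos hn]
      have hX : (MvPowerSeries.X i : MvPowerSeries (Fin m) k) ∈ mI m k :=
        Ideal.subset_span (Set.mem_range_self i)
      exact Ideal.mem_of_dvd _ hd (Ideal.pow_mem_pow hX K)
    have h2 : r - r1 ∈ mI m k ^ K := by
      apply ih
      intro n hn
      rw [map_sub, c1]
      split_ifs with h
      · rw [hr n, sub_zero]
        intro j hj
        rcases Finset.mem_insert.1 hj with rfl | hj
        · exact h
        · exact hn j hj
      · rw [sub_self]
    have := Ideal.add_mem _ h2 h1
    simpa using this

lemma resid_repr (N : ℕ) (l : MvPowerSeries (Fin m) k →ₗ[k] k) (hl : ∀ r ∈ mI m k ^ N, l r = 0) :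
    ∃ e : SQ (SS k m m) (VV k m m), ∀ r : MvPowerSeries (Fin m) k, resid m k (r • e) = l r := by
  let A : Finset (Fin m →₀ ℕ) := Finset.Iic (Finsupp.equivFunOnFinite.symm fun _ => N)
  let f : LS m k := ∑ n ∈ A, mono (fun i => -1 - (n i : ℤ)) (l (MvPowerSeries.monomial n 1))
  refine ⟨Submodule.Quotient.mk ⟨f, mem_SS_top f⟩, fun r => ?_⟩
  rw [resid_smul_mk]
  have hr : l r = l (∑ n ∈ A, MvPowerSeries.monomial n (MvPowerSeries.coeff n r)) := by
    rw [← sub_eq_zero, ← map_sub]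
    apply hl
    apply mem_mI_pow N Finset.univ
    intro n hn
    classical
    have hA : n ∈ A := by
      rw [Finset.mem_Iic]
      intro i
      exact (hn i (Finset.mem_univ i)).le
    rw [map_sub, map_sum, Finset.sum_eq_single n]
    · rw [MvPowerSeries.coeff_monomial_same, sub_self]
    · intro b _ hb
      rw [MvPowerSeries.coeff_monomial_ne (Ne.symm hb)]
    · intro h; exact absurd hA h
  rw [hr, map_sum]
  change cf _ (lsEmb m k r * f) = _
  rw [Finset.mul_sum, map_sum]
  apply Finset.sum_congr rfl
  intro n _
  rw [cf_mul_mono]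
  have h1 : ((fun _ => -1) - fun i => -1 - (n i : ℤ)) = expHom m n := by
    ext i; simp [expHom_apply]
  rw [h1, cf_emb]
  have h2 : MvPowerSeries.monomial n (MvPowerSeries.coeff n r) =
    MvPowerSeries.coeff n r • (MvPowerSeries.monomial n (1 : k)) := by
    rw [← map_smul, smul_eq_mul, mul_one]
  rw [h2, map_smul, smul_eq_mul]

lemma mI_le : mI m k ≤ (⊥ : Ideal (MvPowerSeries (Fin m) k)).jacobson := by
  rw [IsLocalRing.jacobson_eq_maximalIdeal _ bot_ne_top, mI, Ideal.span_le]
  rintro _ ⟨i, rfl⟩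
  change _ ∈ nonunits _
  rw [mem_nonunits_iff, MvPowerSeries.isUnit_iff_constantCoeff]
  simp

variable (m k) in
lemma sq_injective : Module.Injective (MvPowerSeries (Fin m) k) (SQ (SS k m m) (VV k m m)) :=
  matlis_baer (mI m k) (resid m k) resid_k resid_nondeg mI_tors resid_repr

lemma X_pow_kills (N : ℕ) (M : Type) [AddCommGroup M] [Module (MvPowerSeries (Fin m) k) M]
    (hN : ∀ r ∈ mI m k ^ N, ∀ x : M, r • x = 0) (i : Fin m) (x : M) :
    (MvPowerSeries.X i : MvPowerSeries (Fin m) k) ^ N • x = 0 :=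
  hN _ (Ideal.pow_mem_pow (Ideal.subset_span (Set.mem_range_self i)) N) x

variable (m k) in
/-- specialisation of the general statement -/
lemma ext_sq (N : ℕ) (M : Type) [AddCommGroup M] [Module (MvPowerSeries (Fin m) k) M]
    (hN : ∀ r ∈ mI m k ^ N, ∀ x : M, r • x = 0) :
    (∀ i : ℕ, i ≠ m →
      Subsingleton (((Ext (MvPowerSeries (Fin m) k)
          (ModuleCat (MvPowerSeries (Fin m) k)) i).obj
        (op (ModuleCat.of _ M))).obj
        (ModuleCat.of _ (MvPowerSeries (Fin m) k)))) ∧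
    Nonempty ((((Ext (MvPowerSeries (Fin m) k)
            (ModuleCat (MvPowerSeries (Fin m) k)) m).obj
          (op (ModuleCat.of _ M))).obj
          (ModuleCat.of _ (MvPowerSeries (Fin m) k))) ≃ₗ[MvPowerSeries (Fin m) k]
          (M →ₗ[MvPowerSeries (Fin m) k] SQ (SS k m m) (VV k m m))) := by
  obtain ⟨e0⟩ := chain_zero (m := m) (k := k)
  refine ext_concl (MvPowerSeries (Fin m) k) M m
    (fun i => SQ (SS k m i) (VV k m i)) (fun i => SQ (SS k m (i+1)) (VV k m i))
    (fun i => sqMap (SS_le i) (le_refl (VV k m i)))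
    (fun i => sqMap (le_refl (SS k m (i+1))) (VV_le i))
    ?_ ?_ ?_ ?_ (sq_injective m k) e0
  · exact fun i _ => sq_inj _
  · exact fun i _ => sq_surj _
  · exact fun i hi => sq_exact (SS_le i) (VV_le i) (SS_le_VV i hi) (SS_inf_VV i hi)
  · intro i hi
    refine ⟨MvPowerSeries.X ⟨i, hi⟩ ^ N, X_pow_kills N M hN _, ?_⟩
    have := chain_bij (k := k) i hi N
    exact this

end Chain

theorem stmt_10 (k : Type) [Field k] (m : ℕ) (hm : 1 ≤ m)
    (M : Type) [AddCommGroup M] [Module (MvPowerSeries (Fin m) k) M]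
    [Module k M] [IsScalarTower k (MvPowerSeries (Fin m) k) M]
    (hM : IsFiniteLength (MvPowerSeries (Fin m) k) M) :
    (∀ i : ℕ, i ≠ m →
      Subsingleton (((Ext (MvPowerSeries (Fin m) k)
          (ModuleCat (MvPowerSeries (Fin m) k)) i).obj
        (op (ModuleCat.of _ M))).obj
        (ModuleCat.of _ (MvPowerSeries (Fin m) k)))) ∧
    ∃ e : (((Ext (MvPowerSeries (Fin m) k)
            (ModuleCat (MvPowerSeries (Fin m) k)) m).obj
          (op (ModuleCat.of _ M))).obj
          (ModuleCat.of _ (MvPowerSeries (Fin m) k))) ≃+ (M →ₗ[k] k),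
      ∀ (r : MvPowerSeries (Fin m) k) (x),
        e (r • x) = (e x) ∘ₗ (DistribMulAction.toLinearMap k M r) := by
  obtain ⟨N, hN⟩ := exists_pow_kills (mI m k) mI_le M hM
  obtain ⟨hz, ⟨e4⟩⟩ := ext_sq m k N M hN
  refine ⟨hz, ?_⟩
  obtain ⟨e3, he3⟩ := matlis_hom (mI m k) (resid m k) resid_k resid_nondeg resid_repr M N hN
  refine ⟨e4.toAddEquiv.trans e3, fun r x => ?_⟩
  ext z
  change e3 (e4 (r • x)) z = e3 (e4 x) (r • z)
  rw [map_smul, he3, he3, map_smul, LinearMap.smul_apply]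
end

section
/- Let W be the ring of integers of a finite unramified extension of ℚ_p, m ≥ 1, R = W[[x₁,…,x_m]] and S = W[[x₁,…,x_m,y₁,…,y_m]], with R regarded as an S-module via the map x_i ↦ x_i, y_i ↦ x_i. Then Ext^i_S(R, S) = 0 for every i ≠ m, and Ext^m_S(R, S) is isomorphic to R as an S-module; in particular it is a free R-module of rank one. -/
/-!
STATEMENT 13: Let W be the ring of integers of a finite unramified extension of ℚ_p,
m ≥ 1, R = W[[x₁,…,x_m]] and S = W[[x₁,…,x_m,y₁,…,y_m]], with R regarded as an
S-module via the W-algebra map S → R sending x_i ↦ x_i and y_i ↦ x_i (a surjective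
map whose kernel is generated by the x_i − y_i).  Then Ext^i_S(R, S) = 0 for every
i ≠ m, and Ext^m_S(R, S) is isomorphic to R as an S-module.
-/

open CategoryTheory Opposite

/-- `ModVia f` is the codomain of the ring homomorphism `f`, regarded as a module over
the domain of `f` via `f`. -/
def ModVia {A B : Type} [CommRing A] [CommRing B] (_f : A →+* B) : Type := B

instance {A B : Type} [CommRing A] [CommRing B] (f : A →+* B) :
    AddCommGroup (ModVia f) := inferInstanceAs (AddCommGroup B)

instance {A B : Type} [CommRing A] [CommRing B] (f : A →+* B) :
    Module A (ModVia f) := Module.compHom B f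

namespace Stmt13

section PS
open MvPowerSeries

variable {σ A : Type} [CommRing A]

lemma mem_span_X (J : Finset σ) (f : MvPowerSeries σ A) :
    f ∈ Ideal.span (X '' (J : Set σ)) ↔
      ∀ n : σ →₀ ℕ, (∀ j ∈ J, n j = 0) → coeff n f = 0 := by
  classical
  constructor
  · intro h
    induction h using Submodule.span_induction with
    | mem x hx =>
      obtain ⟨j, hj, rfl⟩ := hx
      intro n hn
      exact X_dvd_iff.1 dvd_rfl n (hn j hj)
    | zero => simp
    | add x y _ _ hx hy => intro n hn; simp [hx n hn, hy n hn]
    | smul a x _ hx =>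
      intro n hn
      rw [smul_eq_mul, coeff_mul]
      refine Finset.sum_eq_zero fun q hq => ?_
      rw [hx q.2, mul_zero]
      intro j hj
      have := hn j hj
      rw [Finset.HasAntidiagonal.mem_antidiagonal] at hq
      rw [← hq, Finsupp.add_apply] at this
      omega
  · induction J using Finset.induction_on generalizing f with
    | empty =>
      intro h
      have : f = 0 := by ext n; simpa using h n (by simp)
      simp [this]
    | insert j J hj ih =>
      intro h
      let g : MvPowerSeries σ A := fun n => if n j = 0 then coeff n f else 0
      have hg : ∀ n, coeff n g = if n j = 0 then coeff n f else 0 := fun n => rfl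
      have h1 : g ∈ Ideal.span (X '' ((insert j J : Finset σ) : Set σ)) := by
        refine Ideal.span_mono (Set.image_mono ?_) (ih g ?_)
        · simp
        · intro n hn
          rw [hg]
          split_ifs with h0
          · apply h
            intro k hk
            rcases Finset.mem_insert.1 hk with rfl | hk
            · exact h0
            · exact hn k hk
          · rfl
      have h2 : X j ∣ f - g := by
        rw [X_dvd_iff]
        intro n hn
        simp [hg, hn]
      have h3 : f - g ∈ Ideal.span (X '' ((insert j J : Finset σ) : Set σ) : Set (MvPowerSeries σ A)) :=
        Ideal.mem_of_dvd _ h2 (Ideal.subset_span ⟨j, by simp, rfl⟩)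
      simpa using add_mem h3 h1

lemma regX (l : List σ) (hl : l.Nodup) :
    RingTheory.Sequence.IsWeaklyRegular (MvPowerSeries σ A)
      (l.map (X : σ → MvPowerSeries σ A)) := by
  classical
  constructor
  intro i hi
  have hi' : i < l.length := by simpa using hi
  have hid : (Ideal.ofList ((l.map (X : σ → MvPowerSeries σ A)).take i) • ⊤ :
      Submodule (MvPowerSeries σ A) (MvPowerSeries σ A)) =
      Ideal.span (X '' ((l.take i).toFinset : Set σ)) := by
    rw [smul_eq_mul, Ideal.mul_top, Ideal.ofList, ← List.map_take]
    congr 1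
    ext x; simp only [Set.mem_ofPred_eq, List.mem_map, Set.mem_image, List.coe_toFinset]
  rw [hid, isSMulRegular_iff_right_eq_zero_of_smul]
  intro y
  obtain ⟨f, rfl⟩ := Submodule.Quotient.mk_surjective _ y
  rw [← Submodule.Quotient.mk_smul, Submodule.Quotient.mk_eq_zero, Submodule.Quotient.mk_eq_zero,
    mem_span_X, mem_span_X]
  intro h n hn
  have := h (Finsupp.single l[i] 1 + n) ?_
  · rwa [List.getElem_map, smul_eq_mul, X, coeff_add_monomial_mul, one_mul] at this
  · intro j hj
    have : l[i] ≠ j := by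
      rintro rfl
      rw [List.mem_toFinset, List.mem_take_iff_getElem] at hj
      obtain ⟨k, hk, hk'⟩ := hj
      have := (hl.getElem_inj_iff).1 hk'
      omega
    simp [hn j hj, this]

variable {τ : Type} [Finite τ]

noncomputable def aa : τ ⊕ τ → MvPowerSeries (τ ⊕ τ) A :=
  Sum.elim (fun i => X (Sum.inl i)) (fun i => X (Sum.inl i) - X (Sum.inr i))

lemma haa : HasSubst (aa (τ := τ) (A := A)) := by
  apply hasSubst_of_constantCoeff_zero
  rintro (i | i) <;> simp [aa]

lemma aa_inv (f : MvPowerSeries (τ ⊕ τ) A) : subst (aa (τ := τ) (A := A)) (subst (aa (τ := τ) (A := A)) f) = f := by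
  rw [subst_comp_subst_apply haa haa]
  have : (fun s => subst (aa (τ := τ) (A := A)) (aa (τ := τ) (A := A) s)) = (X : τ ⊕ τ → MvPowerSeries (τ ⊕ τ) A) := by
    funext s
    rcases s with i | i
    · change subst (aa (τ := τ) (A := A)) (X (Sum.inl i)) = _
      rw [subst_X haa]; rfl
    · change subst (aa (τ := τ) (A := A)) (X (Sum.inl i) - X (Sum.inr i)) = _
      rw [← coe_substAlgHom haa, map_sub, coe_substAlgHom, subst_X haa, subst_X haa]
      simp [aa]
  rw [this, subst_self, id]

noncomputable def θ : MvPowerSeries (τ ⊕ τ) A ≃+* MvPowerSeries (τ ⊕ τ) A :=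
  RingEquiv.ofRingHom (substAlgHom (R := A) haa).toRingHom (substAlgHom (R := A) haa).toRingHom
    (by ext1 f; simpa [coe_substAlgHom] using aa_inv f)
    (by ext1 f; simpa [coe_substAlgHom] using aa_inv f)

lemma θ_X (i : τ) : θ (X (Sum.inr i) : MvPowerSeries (τ ⊕ τ) A) = X (Sum.inl i) - X (Sum.inr i) := by
  change substAlgHom (R := A) haa _ = _
  rw [coe_substAlgHom, subst_X haa]; simp [aa]

lemma regXY (l : List τ) (hl : l.Nodup) :
    RingTheory.Sequence.IsWeaklyRegular (MvPowerSeries (τ ⊕ τ) A)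
      (l.map fun i => (X (Sum.inl i) - X (Sum.inr i) : MvPowerSeries (τ ⊕ τ) A)) := by
  have h := regX (A := A) (l.map (Sum.inr : τ → τ ⊕ τ)) (hl.map Sum.inr_injective)
  refine (AddEquiv.isWeaklyRegular_congr (e := (θ (τ := τ) (A := A)).toAddEquiv) ?_).1 h
  rw [List.map_map, List.forall₂_map_left_iff, List.forall₂_map_right_iff, List.forall₂_same]
  intro i _ x
  simp [θ_X]

end PS

section EX
open Abelian
variable {A : Type} [CommRing A]

def Good (M : ModuleCat.{0} A) (n : ℕ) : Prop :=
  (∀ i, i ≠ n → Subsingleton (Abelian.Ext M (ModuleCat.of A A) i)) ∧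
    Nonempty (Abelian.Ext M (ModuleCat.of A A) n ≃ₗ[A] M)

noncomputable def extCongr {M N : ModuleCat.{0} A} (e : M ≅ N) (Y : ModuleCat.{0} A) (i : ℕ) :
    Abelian.Ext N Y i ≃ₗ[A] Abelian.Ext M Y i where
  toFun x := (Ext.mk₀ e.hom).comp x (zero_add i)
  invFun x := (Ext.mk₀ e.inv).comp x (zero_add i)
  map_add' x y := by simp
  map_smul' r x := by simp
  left_inv x := by simp
  right_inv x := by simp

lemma Good.of_iso {M N : ModuleCat.{0} A} (e : M ≅ N) {n : ℕ} (h : Good M n) : Good N n := by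
  refine ⟨fun i hi => ?_, ?_⟩
  · have := h.1 i hi
    exact (extCongr e _ i).toEquiv.subsingleton
  · obtain ⟨f⟩ := h.2
    exact ⟨(extCongr e _ n).trans (f.trans e.toLinearEquiv)⟩

lemma good_self : Good (ModuleCat.of A A) 0 := by
  constructor
  · intro i hi
    obtain ⟨j, rfl⟩ := Nat.exists_eq_succ_of_ne_zero hi
    exact Ext.subsingleton_of_projective _ _ j
  · exact ⟨(Ext.linearEquiv₀ (R := A)).trans
      ((ModuleCat.homLinearEquiv (S := A)).trans (LinearMap.ringLmapEquivSelf A A A))⟩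

open Pointwise in
lemma good_quot_aux {M N : ModuleCat.{0} A} (r : A) (n : ℕ) (hr : IsSMulRegular M r) (h : Good M n)
    (g : M ⟶ N) (w : (r • 𝟙 M) ≫ g = 0) (hS : (ShortComplex.mk (r • 𝟙 M) g w).ShortExact) :
    (∀ i, i ≠ n + 1 → Subsingleton (Abelian.Ext N (ModuleCat.of A A) i)) ∧
    Nonempty (Abelian.Ext N (ModuleCat.of A A) (n + 1) ≃ₗ[A] QuotSMulTop r M) := by
  obtain ⟨h, ⟨e⟩⟩ := h
  generalize ModuleCat.of A A = Y at *
  have key : ∀ i (x : Abelian.Ext M Y i),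
      (Ext.mk₀ (r • 𝟙 M)).comp x (zero_add i) = r • x := by
    intro i x
    rw [Ext.mk₀_smul, Ext.smul_comp, Ext.mk₀_id_comp]
  have hinj : ∀ x : Abelian.Ext M Y n, r • x = 0 → x = 0 := by
    intro x hx
    apply e.injective
    rw [map_zero]
    apply hr.right_eq_zero_of_smul
    rw [← map_smul, hx, map_zero]
  let c : Abelian.Ext N M 1 := hS.extClass
  let δ : Abelian.Ext M Y n →ₗ[A] Abelian.Ext N Y (n + 1) :=
    { toFun := fun x => c.comp x (add_comm 1 n)
      map_add' := by intro x y; simp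
      map_smul' := by intro a x; simp }
  constructor
  · intro i hi
    refine subsingleton_of_forall_eq 0 fun x => ?_
    have h1 : (Ext.mk₀ g).comp x (zero_add i) = 0 := by
      by_cases hin : i = n
      · subst hin
        apply hinj
        rw [← key, ← Ext.comp_assoc (Ext.mk₀ (r • 𝟙 M)) (Ext.mk₀ g) x (zero_add 0) (zero_add i) (by simp),
          Ext.mk₀_comp_mk₀, w]
        simp
      · have := h i hin
        exact Subsingleton.elim _ _
    cases i with
    | zero =>
      have hg : Epi g := hS.epi_g
      exact Ext.precomp_mk₀_injective_of_epi Y g (h1.trans (map_zero _).symm)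
    | succ j =>
      obtain ⟨y, hy⟩ := Ext.contravariant_sequence_exact₃ hS Y x h1 (add_comm 1 j)
      have := h j (by omega)
      have hy0 : y = 0 := Subsingleton.elim (α := Abelian.Ext M Y j) _ _
      rw [← hy, hy0]
      exact Ext.comp_zero _ _ _ _ _
  · have hsurj : Function.Surjective δ := by
      intro x
      have := h (n + 1) (by omega)
      exact Ext.contravariant_sequence_exact₃ hS Y x
        (Subsingleton.elim (α := Abelian.Ext M Y (n + 1)) _ _) (add_comm 1 n)
    have hker : LinearMap.ker δ = r • (⊤ : Submodule A (Abelian.Ext M Y n)) := by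
      ext x
      rw [LinearMap.mem_ker, Submodule.mem_smul_pointwise_iff_exists]
      constructor
      · intro hx
        obtain ⟨y, hy⟩ := Ext.contravariant_sequence_exact₁ hS Y x (add_comm 1 n) hx
        exact ⟨y, trivial, by rw [← hy]; exact (key n y).symm⟩
      · rintro ⟨y, -, rfl⟩
        rw [← key]
        exact hS.extClass_comp_assoc y (h := add_comm 1 n)
    have e1 := (Submodule.quotEquivOfEq _ _ hker).symm.trans
      (δ.quotKerEquivOfSurjective hsurj)
    exact ⟨e1.symm.trans (QuotSMulTop.congr r e)⟩

lemma good_quot (M : ModuleCat.{0} A) (r : A) (n : ℕ) (hr : IsSMulRegular M r) (h : Good M n) :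
    Good (ModuleCat.of A (QuotSMulTop r M)) (n + 1) :=
  good_quot_aux r n hr h (M.smulShortComplex r).g (M.smulShortComplex r).zero
    hr.smulShortComplex_shortExact

lemma good_list (M : ModuleCat.{0} A) (rs : List A) (n : ℕ)
    (hr : RingTheory.Sequence.IsWeaklyRegular M rs) (h : Good M n) :
    Good (ModuleCat.of A (M ⧸ Ideal.ofList rs • (⊤ : Submodule A M))) (n + rs.length) := by
  induction rs generalizing M n with
  | nil =>
    refine h.of_iso ?_
    exact (Submodule.quotEquivOfEqBot _ (by simp)).symm.toModuleIso
  | cons x rs ih =>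
    rw [RingTheory.Sequence.isWeaklyRegular_cons_iff] at hr
    have := ih (ModuleCat.of A (QuotSMulTop x M)) (n + 1) hr.2 (good_quot M x n hr.1 h)
    have := this.of_iso (Submodule.quotOfListConsSMulTopEquivQuotSMulTopInner M x rs).symm.toModuleIso
    rwa [List.length_cons, add_comm rs.length, ← add_assoc]

end EX

section BR
variable {A : Type} [CommRing A]

open CategoryTheory.ProjectiveResolution in
lemma bridge_succ (X Y : ModuleCat.{0} A) (k : ℕ) :
    Nonempty (((Ext A (ModuleCat.{0} A) (k + 1)).obj (op X)).obj Y ≅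
      ModuleCat.of A (Abelian.Ext X Y (k + 1))) := by
  let P := projectiveResolution X
  let C := P.complex.linearYonedaObj A Y
  let T := C.sc' k (k + 1) (k + 2)
  have e1 : C.homology (k + 1) ≅ T.homology :=
    ShortComplex.homologyMapIso (C.isoSc' k (k + 1) (k + 2) (by simp) (by simp))
  have hg : ∀ f : P.complex.X (k + 1) ⟶ Y, T.g.hom f = P.complex.d (k + 2) (k + 1) ≫ f :=
    fun f => rfl
  have hf : ∀ f : P.complex.X k ⟶ Y, T.f.hom f = P.complex.d (k + 1) k ≫ f :=
    fun f => rfl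
  let L : LinearMap.ker T.g.hom →ₗ[A] Abelian.Ext X Y (k + 1) :=
    { toFun := fun f => P.extMk (f.1 : P.complex.X (k + 1) ⟶ Y) (k + 2) rfl f.2
      map_add' := fun f g => (P.add_extMk _ _ _ _ _ _).symm
      map_smul' := fun a f => by
        have h := P.extMk_comp_mk₀ (f.1 : P.complex.X (k + 1) ⟶ Y) (k + 2) rfl f.2 (a • 𝟙 Y)
        rw [Abelian.Ext.mk₀_smul, Abelian.Ext.comp_smul, Abelian.Ext.comp_mk₀_id] at h
        refine Eq.trans ?_ h.symm
        congr 1 }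
  have hs : Function.Surjective L := by
    intro α
    obtain ⟨f, hf, rfl⟩ := P.extMk_surjective α (k + 2) rfl
    exact ⟨⟨f, hf⟩, rfl⟩
  have hk : LinearMap.range T.moduleCatToCycles = LinearMap.ker L := by
    ext f
    rw [LinearMap.mem_ker]
    refine Iff.trans ?_ (P.extMk_eq_zero_iff (f.1 : P.complex.X (k + 1) ⟶ Y) (k + 2) rfl f.2 k rfl).symm
    constructor
    · rintro ⟨g, hg⟩
      exact ⟨g, congrArg Subtype.val hg⟩
    · rintro ⟨g, hg⟩
      exact ⟨g, Subtype.ext hg⟩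
  exact ⟨P.isoExt (k + 1) Y ≪≫ e1 ≪≫ T.moduleCatHomologyIso ≪≫
    ((Submodule.quotEquivOfEq _ _ hk).trans (L.quotKerEquivOfSurjective hs)).toModuleIso⟩

lemma bridge_zero (X Y : ModuleCat.{0} A) (h : Subsingleton (X ⟶ Y)) :
    Subsingleton (((Ext A (ModuleCat.{0} A) 0).obj (op X)).obj Y) := by
  let P := projectiveResolution X
  let C := P.complex.linearYonedaObj A Y
  let T := C.sc' 0 0 1
  have e1 : C.homology 0 ≅ T.homology :=
    ShortComplex.homologyMapIso (C.isoSc' 0 0 1 (by simp) (by simp))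
  have : Subsingleton (LinearMap.ker T.g.hom) := by
    refine subsingleton_of_forall_eq 0 fun f => Subtype.ext ?_
    have hf : P.complex.d 1 0 ≫ (f.1 : P.complex.X 0 ⟶ Y) = 0 := f.2
    have he : Epi (P.π.f 0) := inferInstance
    let u : X ⟶ Y := P.exact₀.desc (f.1 : P.complex.X 0 ⟶ Y) hf
    have hu : P.π.f 0 ≫ u = (f.1 : P.complex.X 0 ⟶ Y) := P.exact₀.g_desc _ hf
    rw [Subsingleton.elim u 0] at hu
    exact hu.symm.trans Limits.comp_zero
  have : Subsingleton T.moduleCatLeftHomologyData.H :=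
    inferInstanceAs (Subsingleton (LinearMap.ker T.g.hom ⧸ _))
  exact (P.isoExt 0 Y ≪≫ e1 ≪≫ T.moduleCatHomologyIso).toLinearEquiv.toEquiv.subsingleton

end BR

end Stmt13

theorem stmt_13 (p : ℕ) [Fact p.Prime] (K : Type) [Field K]
    [Algebra ℚ_[p] K] [FiniteDimensional ℚ_[p] K]
    [Algebra ℤ_[p] K] [IsScalarTower ℤ_[p] ℚ_[p] K]
    (hloc : IsLocalRing (integralClosure ℤ_[p] K))
    (hunram : @IsLocalRing.maximalIdeal _ _ hloc =
      Ideal.span {(p : integralClosure ℤ_[p] K)})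
    (m : ℕ) (hm : 1 ≤ m)
    (φ : MvPowerSeries (Fin m ⊕ Fin m) (integralClosure ℤ_[p] K) →ₐ[integralClosure ℤ_[p] K]
      MvPowerSeries (Fin m) (integralClosure ℤ_[p] K))
    (hx : ∀ i : Fin m, φ (MvPowerSeries.X (Sum.inl i)) = MvPowerSeries.X i)
    (hy : ∀ i : Fin m, φ (MvPowerSeries.X (Sum.inr i)) = MvPowerSeries.X i)
    (hsurj : Function.Surjective φ)
    (hker : RingHom.ker φ.toRingHom = Ideal.span (Set.range fun i : Fin m =>
      MvPowerSeries.X (Sum.inl i) - MvPowerSeries.X (Sum.inr i))) :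
    (∀ i : ℕ, i ≠ m →
      Subsingleton (((Ext (MvPowerSeries (Fin m ⊕ Fin m) (integralClosure ℤ_[p] K))
          (ModuleCat (MvPowerSeries (Fin m ⊕ Fin m) (integralClosure ℤ_[p] K))) i).obj
        (op (ModuleCat.of _ (ModVia φ.toRingHom)))).obj
        (ModuleCat.of _ (MvPowerSeries (Fin m ⊕ Fin m) (integralClosure ℤ_[p] K))))) ∧
    Nonempty ((((Ext (MvPowerSeries (Fin m ⊕ Fin m) (integralClosure ℤ_[p] K))
          (ModuleCat (MvPowerSeries (Fin m ⊕ Fin m) (integralClosure ℤ_[p] K))) m).obj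
        (op (ModuleCat.of _ (ModVia φ.toRingHom)))).obj
        (ModuleCat.of _ (MvPowerSeries (Fin m ⊕ Fin m) (integralClosure ℤ_[p] K)))) ≅
      ModuleCat.of _ (ModVia φ.toRingHom)) := by
  let S := MvPowerSeries (Fin m ⊕ Fin m) (integralClosure ℤ_[p] K)
  let rs : List S := (List.finRange m).map fun i =>
    (MvPowerSeries.X (Sum.inl i) - MvPowerSeries.X (Sum.inr i) : S)
  have hreg : RingTheory.Sequence.IsWeaklyRegular S rs :=
    Stmt13.regXY _ (List.nodup_finRange m)
  have hlen : rs.length = m := by simp [rs]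
  have hgood := Stmt13.good_list (ModuleCat.of S S) rs 0 hreg Stmt13.good_self
  rw [zero_add, hlen] at hgood
  let L : S →ₗ[S] ModVia φ.toRingHom :=
    { toFun := fun s => φ s
      map_add' := fun x y => map_add φ x y
      map_smul' := fun x y => map_mul φ x y }
  have hL : Function.Surjective L := hsurj
  have hLk : (Ideal.ofList rs • ⊤ : Submodule S S) = LinearMap.ker L := by
    have h1 : LinearMap.ker L = RingHom.ker φ.toRingHom := by ext; rfl
    rw [h1, hker, smul_eq_mul, Ideal.mul_top, Ideal.ofList]
    congr 1
    ext x
    simp [rs]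
  have hG : Stmt13.Good (ModuleCat.of S (ModVia φ.toRingHom)) m :=
    hgood.of_iso
      ((Submodule.quotEquivOfEq _ _ hLk).trans (L.quotKerEquivOfSurjective hL)).toModuleIso
  constructor
  · intro i hi
    have h := hG.1 i hi
    cases i with
    | zero =>
      exact Stmt13.bridge_zero _ _ (Abelian.Ext.homEquiv₀.subsingleton_congr.mp h)
    | succ k =>
      obtain ⟨e⟩ := Stmt13.bridge_succ (ModuleCat.of S (ModVia φ.toRingHom)) (ModuleCat.of S S) k
      have : Subsingleton (ModuleCat.of S (Abelian.Ext (ModuleCat.of S (ModVia φ.toRingHom))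
        (ModuleCat.of S S) (k + 1))) := h
      exact e.toLinearEquiv.toEquiv.subsingleton
  · obtain ⟨e⟩ := hG.2
    obtain ⟨k, rfl⟩ : ∃ k, m = k + 1 := ⟨m - 1, by omega⟩
    obtain ⟨e'⟩ := Stmt13.bridge_succ (ModuleCat.of S (ModVia φ.toRingHom)) (ModuleCat.of S S) k
    exact ⟨e' ≪≫ e.toModuleIso⟩
end

section
/- Let W be the ring of integers of a finite unramified extension of ℚ_p, m ≥ 1, and R = W[[x₁,…,x_m]] (a regular local ring of dimension m+1). For every finite length R-module M, Ext^i_R(M, R) = 0 for all i ≠ m+1, and there is an isomorphism of R-modules Ext^{m+1}_R(M, R) ≅ Hom_{ℤ_p}(M, ℚ_p/ℤ_p), where R acts on the Hom through its action on M; that is, Gorenstein duality over R agrees with Pontryagin duality on finite length R-modules. -/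
open CategoryTheory Opposite

namespace S14

section Comparison

variable {R : Type} [CommRing R] {X Y : ModuleCat.{0} R}

lemma smul_extMk (P : ProjectiveResolution X) {n : ℕ} (f : P.complex.X n ⟶ Y) (m : ℕ)
    (hm : n + 1 = m) (hf : P.complex.d m n ≫ f = 0) (r : R)
    (hf' : P.complex.d m n ≫ (r • f) = 0) :
    P.extMk (r • f) m hm hf' = r • P.extMk f m hm hf := by
  rw [Abelian.Ext.smul_eq_comp_mk₀, ProjectiveResolution.extMk_comp_mk₀]
  congr 1

lemma hom_zero (P : ProjectiveResolution X) (h : ∀ f : X ⟶ Y, f = 0) (f : P.complex.X 0 ⟶ Y)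
    (hf : P.complex.d 1 0 ≫ f = 0) : f = 0 := by
  let c := Limits.CokernelCofork.ofπ f hf
  have h1 : P.π.f 0 ≫ P.isColimitCokernelCofork.desc c = f :=
    P.isColimitCokernelCofork.fac c Limits.WalkingParallelPair.one
  have h2 : P.isColimitCokernelCofork.desc c = 0 := by
    have := h ((HomologicalComplex.singleObjXSelf (.down ℕ) 0 X).inv ≫
      P.isColimitCokernelCofork.desc c)
    exact (cancel_epi (HomologicalComplex.singleObjXSelf (.down ℕ) 0 X).inv).1
      (this.trans (Limits.comp_zero).symm)
  rw [← h1, h2]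
  exact Limits.comp_zero

/-- Cocycle to Ext class, linear. -/
noncomputable def extMkLin (P : ProjectiveResolution X) (n : ℕ) :
    LinearMap.ker ((P.complex.linearYonedaObj R Y).sc' (n) (n+1) (n+2)).g.hom →ₗ[R]
      Abelian.Ext X Y (n+1) where
  toFun f := P.extMk (n := n+1) f.1 (n+2) rfl f.2
  map_add' f g := (P.add_extMk (n := n+1) f.1 g.1 (n+2) rfl f.2 g.2).symm
  map_smul' r f := smul_extMk P (n := n+1) f.1 (n+2) rfl f.2 r _

lemma ext_old_new (n : ℕ) :
    Nonempty (((Ext R (ModuleCat.{0} R) (n+1)).obj (op X)).obj Y ≃ₗ[R] Abelian.Ext X Y (n+1)) := by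
  let P := projectiveResolution X
  let K := P.complex.linearYonedaObj R Y
  let S := K.sc' n (n+1) (n+2)
  have e1 : ((Ext R (ModuleCat.{0} R) (n+1)).obj (op X)).obj Y ≅ S.moduleCatLeftHomologyData.H :=
    P.isoExt (R := R) (n+1) Y ≪≫ K.homologyIsoSc' n (n+1) (n+2) (by simp) (by simp) ≪≫
      S.moduleCatHomologyIso
  have hker : LinearMap.ker (extMkLin (Y := Y) P n) = LinearMap.range S.moduleCatToCycles := by
    ext f
    rw [LinearMap.mem_ker]
    refine (P.extMk_eq_zero_iff (n := n+1) f.1 (n+2) rfl f.2 n rfl).trans ?_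
    constructor
    · rintro ⟨g, hg⟩
      exact ⟨g, Subtype.ext hg⟩
    · rintro ⟨g, hg⟩
      exact ⟨g, congrArg Subtype.val hg⟩
  have hsurj : Function.Surjective (extMkLin (Y := Y) P n) := by
    intro α
    obtain ⟨f, hf, h⟩ := P.extMk_surjective α (n+2) rfl
    exact ⟨⟨f, hf⟩, h⟩
  have e2 : (LinearMap.ker S.g.hom ⧸ LinearMap.range S.moduleCatToCycles) ≃ₗ[R]
      Abelian.Ext X Y (n+1) :=
    (Submodule.quotEquivOfEq _ _ hker.symm).trans
      ((extMkLin (Y := Y) P n).quotKerEquivOfSurjective hsurj)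
  exact ⟨e1.toLinearEquiv.trans e2⟩

lemma ext_old_zero (h : ∀ f : X ⟶ Y, f = 0) :
    Subsingleton (((Ext R (ModuleCat.{0} R) 0).obj (op X)).obj Y) := by
  let P := projectiveResolution X
  let K := P.complex.linearYonedaObj R Y
  let S := K.sc' 0 0 1
  have e1 : ((Ext R (ModuleCat.{0} R) 0).obj (op X)).obj Y ≅ S.moduleCatLeftHomologyData.H :=
    P.isoExt (R := R) 0 Y ≪≫ K.homologyIsoSc' 0 0 1 (by simp) (by simp) ≪≫
      S.moduleCatHomologyIso
  have : Subsingleton (LinearMap.ker S.g.hom) := by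
    rw [subsingleton_iff_forall_eq 0]
    rintro ⟨f, hf⟩
    ext1
    exact hom_zero P h f hf
  have : Subsingleton (LinearMap.ker S.g.hom ⧸ LinearMap.range S.moduleCatToCycles) := inferInstance
  have : Subsingleton S.moduleCatLeftHomologyData.H := this
  exact e1.toLinearEquiv.toEquiv.subsingleton

end Comparison

section Hom

variable (R : Type) [CommRing R]

/-- Ext groups into the ring. -/
abbrev E (M : Type) [AddCommGroup M] [Module R M] (n : ℕ) : Type :=
  Abelian.Ext (ModuleCat.of R M) (ModuleCat.of R R) n

variable {R}
variable {A B C : Type} [AddCommGroup A] [Module R A] [AddCommGroup B] [Module R B]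
  [AddCommGroup C] [Module R C]

/-- Contravariant functoriality. -/
noncomputable def Emap (f : A →ₗ[R] B) (n : ℕ) : E R B n →ₗ[R] E R A n where
  toFun x := (Abelian.Ext.mk₀ (ModuleCat.ofHom f)).comp x (zero_add n)
  map_add' x y := by simp
  map_smul' r x := by simp

lemma Emap_comp (f : A →ₗ[R] B) (g : B →ₗ[R] C) (n : ℕ) (x : E R C n) :
    Emap (g ∘ₗ f) n x = Emap f n (Emap g n x) := by
  simp [Emap, ModuleCat.ofHom_comp]

lemma Emap_id (n : ℕ) (x : E R A n) : Emap (LinearMap.id : A →ₗ[R] A) n x = x := by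
  simp [Emap]

lemma Emap_zero (n : ℕ) (x : E R B n) : Emap (0 : A →ₗ[R] B) n x = 0 := by
  have : ModuleCat.ofHom (0 : A →ₗ[R] B) = 0 := rfl
  simp [Emap, this]

lemma Emap_add (f g : A →ₗ[R] B) (n : ℕ) (x : E R B n) :
    Emap (f + g) n x = Emap f n x + Emap g n x := by
  have : ModuleCat.ofHom (f + g) = ModuleCat.ofHom f + ModuleCat.ofHom g := rfl
  simp [Emap, this, Abelian.Ext.mk₀_add]

lemma Emap_smul (r : R) (f : A →ₗ[R] B) (n : ℕ) (x : E R B n) :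
    Emap (r • f) n x = r • Emap f n x := by
  have : ModuleCat.ofHom (r • f) = r • ModuleCat.ofHom f := rfl
  simp [Emap, this, Abelian.Ext.mk₀_smul]

lemma Emap_subsingleton [Subsingleton A] (n : ℕ) : Subsingleton (E R A n) := by
  rw [subsingleton_iff_forall_eq 0]
  intro x
  rw [← Emap_id n x, Subsingleton.elim (LinearMap.id : A →ₗ[R] A) 0, Emap_zero]

/-- Equivalence induced by an isomorphism. -/
lemma Emap_equiv_surj (e : A ≃ₗ[R] B) (n : ℕ) : Function.Surjective (Emap e.toLinearMap n) := by
  intro x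
  refine ⟨Emap e.symm.toLinearMap n x, ?_⟩
  rw [← Emap_comp]
  simp [Emap_id]

section SES

variable (f : A →ₗ[R] B) (g : B →ₗ[R] C)

lemma ses (hf : Function.Injective f) (hfg : Function.Exact f g)
    (hg : Function.Surjective g) : (ShortComplex.moduleCatMk f g hfg.linearMap_comp_eq_zero).ShortExact :=
  ModuleCat.shortComplex_shortExact _ hfg hf hg

lemma ex2 (hf : Function.Injective f) (hfg : Function.Exact f g)
    (hg : Function.Surjective g) (n : ℕ) (x : E R B n) (hx : Emap f n x = 0) : ∃ y, Emap g n y = x :=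
  Abelian.Ext.contravariant_sequence_exact₂ (ses f g hf hfg hg) _ x hx

lemma ex_delta (hf : Function.Injective f) (hfg : Function.Exact f g)
    (hg : Function.Surjective g) (n : ℕ) : ∃ δ : E R A n →ₗ[R] E R C (n+1),
    (∀ x, δ x = 0 ↔ ∃ y, Emap f n y = x) ∧ (∀ x, Emap g (n+1) x = 0 ↔ ∃ y, δ y = x) := by
  have hS := ses f g hf hfg hg
  refine ⟨{ toFun := fun x => hS.extClass.comp x (add_comm 1 n)
            map_add' := fun x y => Abelian.Ext.comp_add _ _ _ _
            map_smul' := fun r x => Abelian.Ext.comp_smul _ _ _ _ }, ?_, ?_⟩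
  · intro x
    constructor
    · exact Abelian.Ext.contravariant_sequence_exact₁ hS _ x (add_comm 1 n)
    · rintro ⟨y, rfl⟩
      exact hS.extClass_comp_assoc y (h := add_comm 1 n)
  · intro x
    constructor
    · intro hx
      exact Abelian.Ext.contravariant_sequence_exact₃ hS _ x hx (add_comm 1 n)
    · rintro ⟨y, rfl⟩
      exact hS.comp_extClass_assoc y (add_comm 1 n)

lemma inj_succ (hf : Function.Injective f) (hfg : Function.Exact f g)
    (hg : Function.Surjective g) (n : ℕ) [Subsingleton (E R A n)] : Function.Injective (Emap g (n+1)) := by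
  obtain ⟨δ, -, h⟩ := ex_delta f g hf hfg hg n
  rw [injective_iff_map_eq_zero]
  intro x hx
  obtain ⟨y, rfl⟩ := (h x).1 hx
  rw [Subsingleton.elim y 0, map_zero]

lemma surj_of (hf : Function.Injective f) (hfg : Function.Exact f g)
    (hg : Function.Surjective g) (n : ℕ) [Subsingleton (E R C (n+1))] : Function.Surjective (Emap f n) := by
  obtain ⟨δ, h, -⟩ := ex_delta f g hf hfg hg n
  intro x
  exact (h x).1 (Subsingleton.elim _ _)

lemma sub_of (hf : Function.Injective f) (hfg : Function.Exact f g)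
    (hg : Function.Surjective g) (n : ℕ) [Subsingleton (E R A n)] [Subsingleton (E R C n)] :
    Subsingleton (E R B n) := by
  rw [subsingleton_iff_forall_eq 0]
  intro x
  obtain ⟨y, rfl⟩ := ex2 f g hf hfg hg n x (Subsingleton.elim _ _)
  rw [Subsingleton.elim y 0, map_zero]

lemma inj_zero (hg : Function.Surjective g) : Function.Injective (Emap g 0) := by
  have : Epi (ModuleCat.ofHom g) := (ModuleCat.epi_iff_surjective _).2 hg
  exact Abelian.Ext.precomp_mk₀_injective_of_epi _ (ModuleCat.ofHom g)

end SES

/-- The ideal `I` has the Gorenstein of grade `j` property. -/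
def Gor (I : Ideal R) (j : ℕ) : Prop :=
  (∀ i, i ≠ j → Subsingleton (E R (R ⧸ I) i)) ∧ Nonempty (E R (R ⧸ I) j ≃ₗ[R] (R ⧸ I))

lemma gor_bot : Gor (⊥ : Ideal R) 0 := by
  have e : (R ⧸ (⊥ : Ideal R)) ≃ₗ[R] R := Submodule.quotEquivOfEqBot _ rfl
  have : Module.Projective R (R ⧸ (⊥ : Ideal R)) := Module.Projective.of_equiv e.symm
  constructor
  · intro i hi
    obtain ⟨i, rfl⟩ := Nat.exists_eq_succ_of_ne_zero hi
    rw [subsingleton_iff_forall_eq 0]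
    have : Projective (ModuleCat.of R (R ⧸ (⊥ : Ideal R))) :=
      (IsProjective.iff_projective _).1 this
    intro x
    exact Abelian.Ext.eq_zero_of_projective x
  · have e1 : E R (R ⧸ (⊥ : Ideal R)) 0 ≃ₗ[R] ((R ⧸ (⊥ : Ideal R)) →ₗ[R] R) :=
      Abelian.Ext.linearEquiv₀.trans ModuleCat.homLinearEquiv
    have e2 : ((R ⧸ (⊥ : Ideal R)) →ₗ[R] R) ≃ₗ[R] (R →ₗ[R] R) := e.congrLeft R R
    exact ⟨e1.trans (e2.trans ((LinearMap.ringLmapEquivSelf R R R).trans e.symm))⟩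

lemma gor_succ (I I' : Ideal R) (a : R) (h1 : ∀ f, a * f ∈ I → f ∈ I)
    (h2 : ∀ f, f ∈ I' ↔ ∃ g, f - a * g ∈ I) (j : ℕ) (h : Gor I j) : Gor I' (j+1) := by
  obtain ⟨hv, ⟨e⟩⟩ := h
  have hle : I ≤ I' := fun f hf => (h2 f).2 ⟨0, by simpa using hf⟩
  let f : (R ⧸ I) →ₗ[R] (R ⧸ I) := a • LinearMap.id
  let g : (R ⧸ I) →ₗ[R] (R ⧸ I') := Submodule.factor hle
  have hf' : ∀ x : R ⧸ I, a • x = 0 → x = 0 := by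
    intro x hx
    obtain ⟨x, rfl⟩ := Ideal.Quotient.mk_surjective x
    have : Ideal.Quotient.mk I (a * x) = 0 := hx
    rw [Ideal.Quotient.eq_zero_iff_mem] at this ⊢
    exact h1 _ this
  have hf : Function.Injective f := by
    rw [injective_iff_map_eq_zero]
    exact hf'
  have hg : Function.Surjective g := Submodule.factor_surjective hle
  have hfg : Function.Exact f g := by
    intro x
    obtain ⟨x, rfl⟩ := Ideal.Quotient.mk_surjective x
    have : g (Ideal.Quotient.mk I x) = Ideal.Quotient.mk I' x := rfl
    rw [this, Ideal.Quotient.eq_zero_iff_mem, h2]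
    constructor
    · rintro ⟨y, hy⟩
      refine ⟨Ideal.Quotient.mk I y, ?_⟩
      have : f (Ideal.Quotient.mk I y) = Ideal.Quotient.mk I (a * y) := rfl
      rw [this]
      exact ((Ideal.Quotient.mk_eq_mk_iff_sub_mem _ _).2 hy).symm
    · rintro ⟨y, hy⟩
      obtain ⟨y, rfl⟩ := Ideal.Quotient.mk_surjective y
      refine ⟨y, (Ideal.Quotient.mk_eq_mk_iff_sub_mem _ _).1 ?_⟩
      exact hy.symm
  have hEf : ∀ n x, Emap f n x = a • x := by
    intro n x
    rw [Emap_smul, Emap_id]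
  constructor
  · intro i hi
    have hinj : Function.Injective (Emap g i) := by
      cases i with
      | zero => exact inj_zero g hg
      | succ i =>
        have := hv i (by omega)
        exact inj_succ f g hf hfg hg i
    rw [subsingleton_iff_forall_eq 0]
    intro x
    apply hinj
    rw [map_zero]
    have ha : a • Emap g i x = 0 := by
      rw [← hEf, ← Emap_comp, hfg.linearMap_comp_eq_zero, Emap_zero]
    by_cases hij : i = j
    · subst hij
      apply e.injective
      rw [map_zero]
      apply hf'
      rw [← map_smul, ha, map_zero]
    · have := hv i hij
      exact Subsingleton.elim _ _
  · obtain ⟨δ, hδ1, hδ2⟩ := ex_delta f g hf hfg hg j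
    have := hv (j+1) (by omega)
    let q : (R ⧸ I) →ₗ[R] E R (R ⧸ I') (j+1) := δ ∘ₗ e.symm.toLinearMap
    have hq : Function.Surjective q := by
      intro x
      obtain ⟨y, rfl⟩ := (hδ2 x).1 (Subsingleton.elim _ _)
      exact ⟨e y, by simp [q]⟩
    have hk : LinearMap.ker q = LinearMap.ker g := by
      ext x
      rw [LinearMap.mem_ker, LinearMap.mem_ker]
      refine (hδ1 _).trans (Iff.trans ?_ (hfg x).symm)
      constructor
      · rintro ⟨y, hy⟩
        refine ⟨e y, ?_⟩
        change a • e y = x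
        rw [← map_smul, ← hEf, hy]; simp
      · rintro ⟨y, rfl⟩
        refine ⟨e.symm y, ?_⟩
        rw [hEf]
        change _ = e.symm (a • y)
        rw [map_smul]
    exact ⟨(q.quotKerEquivOfSurjective hq).symm.trans ((Submodule.quotEquivOfEq _ _ hk).trans
      (g.quotKerEquivOfSurjective hg))⟩

end Hom

section Dev

variable {R : Type} [CommRing R] {A : Type} [CommRing A] [Algebra A R]
  {Q : Type} [AddCommGroup Q] [Module A Q]

lemma exact_sub {M : Type} [AddCommGroup M] [Module R M] (N : Submodule R M) :
    Function.Exact N.subtype N.mkQ := by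
  rw [LinearMap.exact_iff]; simp

lemma vanish (I : Ideal R) (d : ℕ) (hI : Gor I d)
    (hs : ∀ (M : Type) [AddCommGroup M] [Module R M], IsSimpleModule R M →
      Nonempty (M ≃ₗ[R] (R ⧸ I)))
    (M : Type) [AddCommGroup M] [Module R M] (hM : IsFiniteLength R M) (i : ℕ) (hi : i ≠ d) :
    Subsingleton (E R M i) := by
  induction hM with
  | of_subsingleton => exact Emap_subsingleton i
  | @of_simple_quotient M _ _ N hN _ ih =>
    obtain ⟨e⟩ := hs _ hN
    have := hI.1 i hi
    have : Subsingleton (E R (M ⧸ N) i) := (Emap_equiv_surj e i).subsingleton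
    exact sub_of N.subtype N.mkQ N.subtype_injective (exact_sub N) N.mkQ_surjective i

/-- the map `R/J → M` determined by an element -/
def phi (J : Ideal R) {M : Type} [AddCommGroup M] [Module R M]
    (hJ : ∀ r ∈ J, ∀ m : M, r • m = 0) (m : M) : (R ⧸ J) →ₗ[R] M :=
  Submodule.liftQ J (LinearMap.toSpanSingleton R M m) (fun r hr => hJ r hr m)

lemma phi_ext (J : Ideal R) {M : Type} [AddCommGroup M] [Module R M]
    (f g : (R ⧸ J) →ₗ[R] M) (h : f 1 = g 1) : f = g := by
  apply Submodule.linearMap_qext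
  ext
  exact h

lemma phi_one (J : Ideal R) {M : Type} [AddCommGroup M] [Module R M]
    (hJ : ∀ r ∈ J, ∀ m : M, r • m = 0) (m : M) : phi J hJ m 1 = m := by
  change (1 : R) • m = m
  simp

/-- the pairing -/
noncomputable def beta (J : Ideal R) (d : ℕ) (l : E R (R ⧸ J) d →+ Q)
    (hl : ∀ (a : A) x, l (algebraMap A R a • x) = a • l x)
    (M : Type) [AddCommGroup M] [Module R M] [Module A M] [IsScalarTower A R M]
    (hJ : ∀ r ∈ J, ∀ m : M, r • m = 0) : E R M d →+ (M →ₗ[A] Q) where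
  toFun x :=
    { toFun := fun m => l (Emap (phi J hJ m) d x)
      map_add' := by
        intro m m'
        rw [← map_add, ← Emap_add]
        congr 3
        apply phi_ext
        simp [phi_one]
      map_smul' := by
        intro a m
        rw [RingHom.id_apply, ← hl, ← Emap_smul]
        congr 3
        apply phi_ext
        simp [phi_one] }
  map_zero' := by ext; simp
  map_add' x y := by ext; simp

lemma beta_apply (J : Ideal R) (d : ℕ) (l : E R (R ⧸ J) d →+ Q)
    (hl : ∀ (a : A) x, l (algebraMap A R a • x) = a • l x)
    (M : Type) [AddCommGroup M] [Module R M] [Module A M] [IsScalarTower A R M]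
    (hJ : ∀ r ∈ J, ∀ m : M, r • m = 0) (x : E R M d) (m : M) :
    beta J d l hl M hJ x m = l (Emap (phi J hJ m) d x) := rfl

lemma beta_smul (J : Ideal R) (d : ℕ) (l : E R (R ⧸ J) d →+ Q)
    (hl : ∀ (a : A) x, l (algebraMap A R a • x) = a • l x)
    (M : Type) [AddCommGroup M] [Module R M] [Module A M] [IsScalarTower A R M]
    (hJ : ∀ r ∈ J, ∀ m : M, r • m = 0) (r : R) (x : E R M d) (m : M) :
    beta J d l hl M hJ (r • x) m = beta J d l hl M hJ x (r • m) := by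
  rw [beta_apply, beta_apply, map_smul, ← Emap_smul]
  congr 3
  apply phi_ext
  simp [phi_one]

lemma beta_nat (J : Ideal R) (d : ℕ) (l : E R (R ⧸ J) d →+ Q)
    (hl : ∀ (a : A) x, l (algebraMap A R a • x) = a • l x)
    (M : Type) [AddCommGroup M] [Module R M] [Module A M] [IsScalarTower A R M]
    (hJ : ∀ r ∈ J, ∀ m : M, r • m = 0)
    (M' : Type) [AddCommGroup M'] [Module R M'] [Module A M'] [IsScalarTower A R M']
    (hJ' : ∀ r ∈ J, ∀ m : M', r • m = 0) (f : M →ₗ[R] M') (x : E R M' d) (m : M) :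
    beta J d l hl M hJ (Emap f d x) m = beta J d l hl M' hJ' x (f m) := by
  rw [beta_apply, beta_apply, ← Emap_comp]
  congr 3
  apply phi_ext
  simp [phi_one]

lemma beta_simple (J I : Ideal R) [I.IsMaximal] (hJI : J ≤ I) (d : ℕ) (hI : Gor I d)
    (l : E R (R ⧸ J) d →+ Q)
    (hl : ∀ (a : A) x, l (algebraMap A R a • x) = a • l x)
    (hl' : ∃ x : E R (R ⧸ I) d, l (Emap (Submodule.factor hJI) d x) ≠ 0)
    [Finite (R ⧸ I)]
    (hcard : ∀ (M : Type) [AddCommGroup M] [Module R M] [Module A M] [IsScalarTower A R M],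
      (M ≃ₗ[R] (R ⧸ I)) → Finite (M →ₗ[A] Q) ∧ Nat.card (M →ₗ[A] Q) ≤ Nat.card (R ⧸ I))
    (M : Type) [AddCommGroup M] [Module R M] [Module A M] [IsScalarTower A R M]
    (hJ : ∀ r ∈ J, ∀ m : M, r • m = 0) (e : M ≃ₗ[R] (R ⧸ I)) :
    Function.Bijective (beta J d l hl M hJ) := by
  obtain ⟨-, ⟨u⟩⟩ := hI
  obtain ⟨hfin, hc⟩ := hcard M e
  have hES : Function.Bijective (Emap e.toLinearMap d) := by
    refine ⟨?_, Emap_equiv_surj e d⟩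
    intro x y hxy
    have := congrArg (Emap e.symm.toLinearMap d) hxy
    rw [← Emap_comp, ← Emap_comp] at this
    simpa [Emap_id] using this
  have hcardE : Nat.card (E R M d) = Nat.card (R ⧸ I) := by
    rw [← Nat.card_congr u.toEquiv, Nat.card_congr (Equiv.ofBijective _ hES)]
  have hinj : Function.Injective (beta J d l hl M hJ) := by
    rw [injective_iff_map_eq_zero]
    intro x hx
    obtain ⟨η, rfl⟩ := hES.2 x
    by_contra hne
    have hη : η ≠ 0 := by rintro rfl; simp at hne
    obtain ⟨y, hy⟩ := hl'
    apply hy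
    have hyr : ∃ r : R, y = r • η := by
      have huη : u η ≠ 0 := by simpa using hη
      let := Ideal.Quotient.field I
      obtain ⟨r, hr⟩ := Ideal.Quotient.mk_surjective (u y * (u η)⁻¹)
      refine ⟨r, u.injective ?_⟩
      rw [map_smul]
      have : r • u η = Ideal.Quotient.mk I r * u η := rfl
      rw [this, hr, mul_assoc, inv_mul_cancel₀ huη, mul_one]
    obtain ⟨r, rfl⟩ := hyr
    have := congrArg (fun F : M →ₗ[A] Q => F (r • e.symm 1)) hx
    simp only [LinearMap.zero_apply] at this
    rw [beta_apply, ← Emap_comp] at this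
    rw [← this, map_smul, ← Emap_smul]
    congr 3
    apply phi_ext
    simp [phi_one]
  have : Finite (E R M d) := Finite.of_injective _ hinj
  exact Function.Injective.bijective_of_nat_card_le hinj (by omega)

lemma beta_bij (J I : Ideal R) [I.IsMaximal] (hJI : J ≤ I) (d : ℕ) (hI : Gor I d)
    (l : E R (R ⧸ J) d →+ Q)
    (hl : ∀ (a : A) x, l (algebraMap A R a • x) = a • l x)
    (hl' : ∃ x : E R (R ⧸ I) d, l (Emap (Submodule.factor hJI) d x) ≠ 0)
    [Finite (R ⧸ I)]
    (hcard : ∀ (M : Type) [AddCommGroup M] [Module R M] [Module A M] [IsScalarTower A R M],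
      (M ≃ₗ[R] (R ⧸ I)) → Finite (M →ₗ[A] Q) ∧ Nat.card (M →ₗ[A] Q) ≤ Nat.card (R ⧸ I))
    (hs : ∀ (M : Type) [AddCommGroup M] [Module R M], IsSimpleModule R M →
      Nonempty (M ≃ₗ[R] (R ⧸ I)))
    (M : Type) [AddCommGroup M] [Module R M] (hM : IsFiniteLength R M) :
    ∀ [Module A M] [IsScalarTower A R M]
    (hJ : ∀ r ∈ J, ∀ m : M, r • m = 0),
    Function.Bijective (beta J d l hl M hJ) := by
  induction hM with
  | @of_subsingleton M _ _ _ =>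
    intro _ _ hJ
    have : Subsingleton (E R M d) := Emap_subsingleton d
    refine ⟨fun _ _ _ => Subsingleton.elim _ _, fun f => ⟨0, ?_⟩⟩
    ext x
    rw [Subsingleton.elim x 0]; simp
  | @of_simple_quotient M _ _ N hN hNl ih =>
    intro _ _ hJ
    have hJN : ∀ r ∈ J, ∀ m : N, r • m = 0 := fun r hr m => Subtype.ext (hJ r hr m)
    have hJQ : ∀ r ∈ J, ∀ m : M ⧸ N, r • m = 0 := by
      intro r hr m
      obtain ⟨m, rfl⟩ := N.mkQ_surjective m
      rw [← map_smul, hJ r hr, map_zero]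
    have bN := ih hJN
    obtain ⟨e⟩ := hs _ hN
    have bQ := beta_simple J I hJI d hI l hl hl' hcard (M ⧸ N) hJQ e
    have hQ : Subsingleton (E R (M ⧸ N) (d+1)) :=
      have := hI.1 (d+1) (by omega)
      (Emap_equiv_surj e (d+1)).subsingleton
    constructor
    · rw [injective_iff_map_eq_zero]
      intro x hx
      have h1 : Emap N.subtype d x = 0 := by
        apply bN.1
        rw [map_zero]
        ext m
        rw [beta_nat J d l hl N hJN M hJ, hx]; simp
      obtain ⟨y, rfl⟩ := ex2 N.subtype N.mkQ N.subtype_injective (exact_sub N) N.mkQ_surjective d x h1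
      have : y = 0 := by
        apply bQ.1
        rw [map_zero]
        ext m
        obtain ⟨m, rfl⟩ := N.mkQ_surjective m
        rw [← beta_nat J d l hl M hJ (M ⧸ N) hJQ, hx]; simp
      rw [this, map_zero]
    · intro F
      obtain ⟨z, hz⟩ := bN.2 (F ∘ₗ (N.subtype.restrictScalars A))
      obtain ⟨x, rfl⟩ := surj_of N.subtype N.mkQ N.subtype_injective (exact_sub N)
        N.mkQ_surjective d z
      have hv : ∀ n : N, F n = beta J d l hl M hJ x n := by
        intro n
        have := congrArg (fun G : N →ₗ[A] Q => G n) hz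
        simp only [beta_nat J d l hl N hJN M hJ] at this
        exact this.symm
      let G := F - beta J d l hl M hJ x
      have hG : ∀ n ∈ N, G n = 0 := fun n hn => by
        simp [G, hv ⟨n, hn⟩]
      let g : (M ⧸ N) →ₗ[A] Q :=
        { toFun := QuotientAddGroup.lift N.toAddSubgroup G.toAddMonoidHom hG
          map_add' := map_add _
          map_smul' := by
            intro a m
            obtain ⟨m, rfl⟩ := N.mkQ_surjective m
            exact G.map_smul a m }
      have hgG : ∀ m, g (N.mkQ m) = G m := fun m => rfl
      obtain ⟨y, hy⟩ := bQ.2 g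
      refine ⟨x + Emap N.mkQ d y, ?_⟩
      ext m
      rw [map_add, LinearMap.add_apply, beta_nat J d l hl M hJ (M ⧸ N) hJQ, hy, hgG]
      simp [G]

/-- existence of the functional -/
lemma exists_l (hQ : Module.Baer A Q) {T k : Type} [AddCommGroup T] [Module R T]
    [AddCommGroup k] [Module R k] [Module A k] [IsScalarTower A R k]
    (j : k →ₗ[R] T) (hj : Function.Injective j) (c : k →ₗ[A] Q) (hc : c ≠ 0) :
    ∃ l : T →+ Q, (∀ (a : A) x, l (algebraMap A R a • x) = a • l x) ∧
      ∃ x, l (j x) ≠ 0 := by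
  let : Module A T := Module.compHom T (algebraMap A R)
  have : IsScalarTower A R T := IsScalarTower.of_algebraMap_smul (fun r x => rfl)
  obtain ⟨h, hh⟩ := Module.Baer.extension_property hQ (j.restrictScalars A) hj c
  refine ⟨h.toAddMonoidHom, fun a x => h.map_smul a x, ?_⟩
  by_contra! hcon
  apply hc
  rw [← hh]
  ext x
  exact hcon x

end Dev

section Padic

variable (p : ℕ) [Fact p.Prime]

/-- `ℚ_p / ℤ_p` -/
abbrev QZ : Type := ℚ_[p] ⧸ LinearMap.range (Algebra.linearMap ℤ_[p] ℚ_[p])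

lemma baer_QZ : Module.Baer ℤ_[p] (QZ p) := by
  intro I g
  obtain ⟨a, rfl⟩ := (IsPrincipalIdealRing.principal I).principal
  by_cases ha : a = 0
  · subst ha
    refine ⟨0, fun x hx => ?_⟩
    have hx0 : x = 0 := by simpa using hx
    subst hx0
    have : (⟨0, hx⟩ : Submodule.span ℤ_[p] {(0 : ℤ_[p])}) = 0 := rfl
    rw [this]; simp
  · have hmem : a ∈ Submodule.span ℤ_[p] {a} := Submodule.mem_span_singleton_self a
    obtain ⟨y, hy⟩ := Submodule.mkQ_surjective _ (g ⟨a, hmem⟩)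
    have ha' : (a : ℚ_[p]) ≠ 0 := by simpa using ha
    refine ⟨LinearMap.toSpanSingleton _ _ (Submodule.mkQ _ ((a : ℚ_[p])⁻¹ * y)), fun x hx => ?_⟩
    obtain ⟨c, rfl⟩ := Submodule.mem_span_singleton.1 hx
    have : (⟨c • a, hx⟩ : Submodule.span ℤ_[p] {a}) = c • ⟨a, hmem⟩ := rfl
    rw [this, g.map_smul c ⟨a, hmem⟩, ← hy, LinearMap.toSpanSingleton_apply, ← map_smul, ← map_smul]
    congr 1
    have : algebraMap ℤ_[p] ℚ_[p] a = (a : ℚ_[p]) := rfl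
    rw [Algebra.smul_def (c • a), smul_eq_mul, map_mul, this, mul_assoc,
      mul_inv_cancel_left₀ ha', Algebra.smul_def]

/-- the residue field -/
abbrev Fp : Type := ℤ_[p] ⧸ Ideal.span {(p : ℤ_[p])}

instance : (Ideal.span {(p : ℤ_[p])}).IsMaximal := by
  rw [← PadicInt.maximalIdeal_eq_span_p]; infer_instance

instance : Finite (Fp p) := by
  have e : IsLocalRing.ResidueField ℤ_[p] ≃+* ZMod p := PadicInt.residueField
  have : Finite (IsLocalRing.ResidueField ℤ_[p]) := Finite.of_equiv _ e.symm.toEquiv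
  rw [Fp, ← PadicInt.maximalIdeal_eq_span_p]
  exact this

/-- the element `1/p`. -/
noncomputable def ip : QZ p := Submodule.mkQ _ ((p : ℚ_[p])⁻¹)

lemma p_ne : (p : ℚ_[p]) ≠ 0 := by
  exact_mod_cast (Fact.out : p.Prime).ne_zero

lemma ip_ne : ip p ≠ 0 := by
  intro h
  rw [ip, Submodule.mkQ_apply, Submodule.Quotient.mk_eq_zero] at h
  obtain ⟨c, hc⟩ := h
  have hc' : (c : ℚ_[p]) = (p : ℚ_[p])⁻¹ := hc
  have h1 : ((p : ℤ_[p]) * c : ℤ_[p]) = 1 := by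
    apply Subtype.ext
    push_cast
    rw [hc', mul_inv_cancel₀ (p_ne p)]
  exact (PadicInt.prime_p (p := p)).not_isUnit (IsUnit.of_mul_eq_one c h1)

/-- the map `F_p → ℚ_p/ℤ_p` -/
noncomputable def tF : Fp p →ₗ[ℤ_[p]] QZ p :=
  Submodule.liftQ _ (LinearMap.toSpanSingleton ℤ_[p] (QZ p) (ip p)) (by
    rw [Ideal.span, Submodule.span_le, Set.singleton_subset_iff]
    rw [SetLike.mem_coe, LinearMap.mem_ker, LinearMap.toSpanSingleton_apply, ip, ← map_smul,
      Submodule.mkQ_apply, Submodule.Quotient.mk_eq_zero]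
    refine ⟨1, ?_⟩
    rw [Algebra.smul_def]
    simp [p_ne p])

lemma tF_one : tF p 1 = ip p := by
  change (1 : ℤ_[p]) • ip p = ip p
  simp

lemma tF_surj (q : QZ p) (hq : (p : ℤ_[p]) • q = 0) : ∃ c, tF p c = q := by
  obtain ⟨y, rfl⟩ := Submodule.mkQ_surjective _ q
  rw [← map_smul, Submodule.mkQ_apply, Submodule.Quotient.mk_eq_zero] at hq
  obtain ⟨c, hc⟩ := hq
  refine ⟨Ideal.Quotient.mk _ c, ?_⟩
  change c • ip p = _
  rw [ip, ← map_smul]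
  congr 1
  rw [Algebra.smul_def] at hc ⊢
  have hc' : algebraMap ℤ_[p] ℚ_[p] c = (p : ℚ_[p]) * y := by simpa using hc
  rw [hc', mul_comm, inv_mul_cancel_left₀ (p_ne p)]

lemma count (X : Type) [AddCommGroup X] [Module ℤ_[p] X] [Module.Finite ℤ_[p] X]
    (hX : ∀ x : X, (p : ℤ_[p]) • x = 0) :
    Finite X ∧ Finite (X →ₗ[ℤ_[p]] QZ p) ∧ Nat.card (X →ₗ[ℤ_[p]] QZ p) ≤ Nat.card X ∧
      (Nontrivial X → ∃ c : X →ₗ[ℤ_[p]] QZ p, c ≠ 0) := by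
  have htor : Module.IsTorsionBySet ℤ_[p] X (Ideal.span {(p : ℤ_[p])} : Ideal ℤ_[p]) := by
    rw [← Module.isTorsionBySet_iff_is_torsion_by_span, Module.isTorsionBySet_singleton_iff]
    exact hX
  let _ : Module (Fp p) X := htor.module
  have _ : IsScalarTower ℤ_[p] (Fp p) X := htor.isScalarTower
  let _ : Field (Fp p) := Ideal.Quotient.field _
  have _ : Module.Finite (Fp p) X := Module.Finite.of_restrictScalars_finite ℤ_[p] _ _
  let b := Module.finBasis (Fp p) X
  have hXf : Finite X := Finite.of_equiv _ b.equivFun.symm.toEquiv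
  have hex : ∀ (f : X →ₗ[ℤ_[p]] QZ p) (i), ∃ c, tF p c = f (b i) := by
    intro f i
    apply tF_surj
    rw [← map_smul, hX, map_zero]
  choose c hc using hex
  have hinj : Function.Injective c := by
    intro f g hfg
    ext x
    rw [← b.sum_repr x, map_sum, map_sum]
    apply Finset.sum_congr rfl
    intro i _
    obtain ⟨r, hr⟩ := Ideal.Quotient.mk_surjective (b.repr x i)
    have : b.repr x i • b i = r • b i := by
      rw [← hr]; exact (htor.mk_smul r (b i))
    rw [this, map_smul, map_smul, ← hc, ← hc, hfg]
  refine ⟨hXf, Finite.of_injective c hinj, ?_, ?_⟩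
  · rw [Nat.card_congr b.equivFun.toEquiv]
    exact Nat.card_le_card_of_injective c hinj
  · intro _
    obtain ⟨x, hx⟩ := exists_ne (0 : X)
    have : ∃ i, b.repr x i ≠ 0 := by
      by_contra! h
      apply hx
      apply b.repr.injective
      ext i
      simp [h i]
    obtain ⟨i, hi⟩ := this
    refine ⟨tF p ∘ₗ ((b.coord i).restrictScalars ℤ_[p]), fun h => ip_ne p ?_⟩
    have := congrArg (fun F : X →ₗ[ℤ_[p]] QZ p => F (b i)) h
    simpa [tF_one] using this

end Padic

section PS

variable (m : ℕ) (W : Type) [CommRing W]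

/-- the ideal `(x_0, …, x_{j-1})`. -/
noncomputable def Ich (j : ℕ) : Ideal (MvPowerSeries (Fin m) W) where
  carrier := {f | ∀ a : Fin m →₀ ℕ, (∀ i : Fin m, i.val < j → a i = 0) →
    MvPowerSeries.coeff a f = 0}
  zero_mem' := by intro a _; simp
  add_mem' := by
    intro f g hf hg a ha
    rw [map_add, hf a ha, hg a ha, add_zero]
  smul_mem' := by
    intro c f hf a ha
    rw [smul_eq_mul, MvPowerSeries.coeff_mul]
    apply Finset.sum_eq_zero
    intro x hx
    rw [Finset.HasAntidiagonal.mem_antidiagonal] at hx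
    rw [hf x.2, mul_zero]
    intro i hi
    have h := ha i hi
    rw [← hx, Finsupp.add_apply] at h
    omega

lemma mem_Ich (j : ℕ) (f : MvPowerSeries (Fin m) W) : f ∈ Ich m W j ↔
    ∀ a : Fin m →₀ ℕ, (∀ i : Fin m, i.val < j → a i = 0) →
    MvPowerSeries.coeff a f = 0 := Iff.rfl

lemma Ich_zero : Ich m W 0 = ⊥ := by
  rw [eq_bot_iff]
  intro f hf
  rw [Ideal.mem_bot]
  ext a
  rw [hf a (by simp), map_zero]

lemma gor_Ich (j : ℕ) (hj : j ≤ m) : Gor (Ich m W j) j := by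
  induction j with
  | zero => rw [Ich_zero]; exact gor_bot
  | succ j ih =>
    let s : Fin m := ⟨j, hj⟩
    refine gor_succ (Ich m W j) (Ich m W (j+1)) (MvPowerSeries.X s) ?_ ?_ j (ih (by omega))
    · intro f hf a ha
      have := hf (Finsupp.single s 1 + a) (by
        intro i hi
        have hne : s ≠ i := by
          rintro rfl
          exact absurd hi (by simp [s])
        rw [Finsupp.add_apply, ha i hi, Finsupp.single_eq_of_ne' hne])
      rwa [MvPowerSeries.X_def, MvPowerSeries.coeff_add_monomial_mul, one_mul] at this
    · intro f
      constructor
      · intro hf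
        let h : MvPowerSeries (Fin m) W := fun a => if a s = 0 then MvPowerSeries.coeff a f else 0
        have hc : ∀ a, MvPowerSeries.coeff a h = if a s = 0 then MvPowerSeries.coeff a f else 0 :=
          fun a => rfl
        have hd : MvPowerSeries.X s ∣ f - h := by
          rw [MvPowerSeries.X_dvd_iff]
          intro a ha
          rw [map_sub, hc, if_pos ha, sub_self]
        obtain ⟨g, hg⟩ := hd
        refine ⟨g, ?_⟩
        rw [← hg, sub_sub_cancel]
        intro a ha
        rw [hc]
        split_ifs with h0
        · apply hf
          intro i hi
          rcases Nat.lt_succ_iff_lt_or_eq.1 hi with h1 | h1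
          · exact ha i h1
          · have : i = s := Fin.ext h1
            rw [this, h0]
        · rfl
      · rintro ⟨g, hg⟩ a ha
        have h1 := hg a (fun i hi => ha i (by omega))
        have h2 : MvPowerSeries.coeff a (MvPowerSeries.X s * g) = 0 :=
          MvPowerSeries.X_dvd_iff.1 (dvd_mul_right _ _) a (ha s (by simp [s]))
        rwa [map_sub, h2, sub_zero] at h1

/-- the ideal `(π, x_1, …, x_m)` -/
noncomputable def Imax (π : W) : Ideal (MvPowerSeries (Fin m) W) :=
  (Ideal.span {π}).comap MvPowerSeries.constantCoeff

lemma gor_Imax (π : W) (hπ : ∀ w, π * w = 0 → w = 0) : Gor (Imax m W π) (m+1) := by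
  have key : ∀ f, f ∈ Ich m W m ↔ MvPowerSeries.constantCoeff f = 0 := by
    intro f
    rw [mem_Ich, ← MvPowerSeries.coeff_zero_eq_constantCoeff_apply]
    constructor
    · intro h
      exact h 0 (by simp)
    · intro h a ha
      have : a = 0 := by
        ext i
        exact ha i i.2
      rw [this, h]
  refine gor_succ (Ich m W m) _ (MvPowerSeries.C π) ?_ ?_ m (gor_Ich m W m le_rfl)
  · intro f
    rw [key, key, map_mul, MvPowerSeries.constantCoeff_C]
    exact hπ _
  · intro f
    rw [Imax, Ideal.mem_comap, Ideal.mem_span_singleton]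
    constructor
    · rintro ⟨w, hw⟩
      refine ⟨MvPowerSeries.C w, ?_⟩
      rw [key, map_sub, map_mul, MvPowerSeries.constantCoeff_C, MvPowerSeries.constantCoeff_C, hw,
        sub_self]
    · rintro ⟨g, hg⟩
      rw [key, map_sub, map_mul, MvPowerSeries.constantCoeff_C, sub_eq_zero] at hg
      exact ⟨_, hg⟩

end PS

section Gen

variable {R : Type} [CommRing R]

lemma simple_iso [IsLocalRing R] (I : Ideal R) [hI : I.IsMaximal]
    (M : Type) [AddCommGroup M] [Module R M] (h : IsSimpleModule R M) :
    Nonempty (M ≃ₗ[R] (R ⧸ I)) := by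
  obtain ⟨I', hI', ⟨e⟩⟩ := isSimpleModule_iff_quot_maximal.1 h
  have : I' = I := by rw [IsLocalRing.eq_maximalIdeal hI', IsLocalRing.eq_maximalIdeal hI]
  subst this
  exact ⟨e⟩

lemma fl_quot (I : Ideal R) [I.IsMaximal] (M : Type) [AddCommGroup M] [Module R M]
    (hM : IsFiniteLength R M) :
    IsFiniteLength R (R ⧸ (Module.annihilator R M ⊓ I)) := by
  rw [isFiniteLength_iff_isNoetherian_isArtinian] at hM ⊢
  obtain ⟨_, _⟩ := hM
  have hs : IsSimpleModule R (R ⧸ I) := isSimpleModule_iff_quot_maximal.2 ⟨I, ‹_›, ⟨.refl _ _⟩⟩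
  obtain ⟨s, hs⟩ := (Module.finite_def.1 (inferInstance : Module.Finite R M))
  let F : R →ₗ[R] ((s → M) × (R ⧸ I)) :=
    (LinearMap.pi fun x : s => LinearMap.toSpanSingleton R M x.1).prod (Submodule.mkQ I)
  have hF : LinearMap.ker F = Module.annihilator R M ⊓ I := by
    ext r
    simp only [F, LinearMap.ker_prod, Submodule.mem_inf, Submodule.ker_mkQ]
    refine and_congr_left fun _ => ?_
    rw [LinearMap.mem_ker, Module.mem_annihilator]
    constructor
    · intro h x
      have hx : x ∈ Submodule.span R (s : Set M) := by rw [hs]; trivial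
      induction hx using Submodule.span_induction with
      | mem x hx => exact congrFun h ⟨x, hx⟩
      | zero => simp
      | add x y _ _ hx hy => rw [smul_add, hx, hy, add_zero]
      | smul a x _ hx => rw [smul_comm, hx, smul_zero]
    · intro h
      ext x
      exact h x.1
  have e := Submodule.quotEquivOfEq _ _ hF
  have hi := LinearMap.ker_eq_bot.1 (Submodule.ker_liftQ_eq_bot' _ F rfl)
  have hi' : Function.Injective ((Submodule.liftQ _ F le_rfl) ∘ₗ e.symm.toLinearMap) :=
    hi.comp e.symm.injective
  exact ⟨isNoetherian_of_injective _ hi', isArtinian_of_injective _ hi'⟩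

end Gen

section Fin

variable {R : Type} [CommRing R] {A : Type} [CommRing A] [Algebra A R]
  {Q : Type} [AddCommGroup Q] [Module A Q]

lemma main_general (I : Ideal R) [I.IsMaximal] [IsLocalRing R] (d : ℕ) (hI : Gor I (d+1))
    (hQ : Module.Baer A Q) [Finite (R ⧸ I)]
    (hcard : ∀ (M : Type) [AddCommGroup M] [Module R M] [Module A M] [IsScalarTower A R M],
      (M ≃ₗ[R] (R ⧸ I)) → Finite (M →ₗ[A] Q) ∧ Nat.card (M →ₗ[A] Q) ≤ Nat.card (R ⧸ I))
    (c : (R ⧸ I) →ₗ[A] Q) (hc : c ≠ 0)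
    (M : Type) [AddCommGroup M] [Module R M] [Module A M] [IsScalarTower A R M]
    (hM : IsFiniteLength R M) :
    (∀ i : ℕ, i ≠ d + 1 →
      Subsingleton (((Ext R (ModuleCat R) i).obj (op (ModuleCat.of R M))).obj
        (ModuleCat.of R R))) ∧
    ∃ e : (((Ext R (ModuleCat R) (d + 1)).obj (op (ModuleCat.of R M))).obj
        (ModuleCat.of R R)) ≃+ (M →ₗ[A] Q),
      ∀ (r : R) (x), e (r • x) = (e x) ∘ₗ (DistribMulAction.toLinearMap A M r) := by
  have hs := fun (M : Type) [AddCommGroup M] [Module R M] (h : IsSimpleModule R M) =>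
    simple_iso I M h
  have hv := vanish I (d+1) hI hs
  constructor
  · intro i hi
    have h := hv M hM i hi
    cases i with
    | zero =>
      apply ext_old_zero
      intro f
      have := Subsingleton.elim (α := E R M 0) (Abelian.Ext.mk₀ f) 0
      rwa [Abelian.Ext.mk₀_eq_zero_iff] at this
    | succ n =>
      obtain ⟨e⟩ := ext_old_new (X := ModuleCat.of R M) (Y := ModuleCat.of R R) n
      exact e.toEquiv.subsingleton
  · let J := Module.annihilator R M ⊓ I
    have hJI : J ≤ I := inf_le_right
    have hJ : ∀ r ∈ J, ∀ x : M, r • x = 0 := fun r hr x =>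
      Module.mem_annihilator.1 hr.1 x
    have hfl : IsFiniteLength R (R ⧸ J) := fl_quot I M hM
    let q : (R ⧸ J) →ₗ[R] (R ⧸ I) := Submodule.factor hJI
    have hker : IsFiniteLength R (LinearMap.ker q) :=
      hfl.of_injective (LinearMap.ker q).subtype_injective
    have hk := hv _ hker d (by omega)
    have hqs : Function.Surjective q := Submodule.factor_surjective hJI
    have hinj : Function.Injective (Emap q (d+1)) :=
      inj_succ (LinearMap.ker q).subtype q (Submodule.subtype_injective _)
        (by rw [LinearMap.exact_iff]; simp) hqs d
    obtain ⟨u⟩ := hI.2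
    obtain ⟨l, hl, x, hx⟩ := exists_l hQ (Emap q (d+1) ∘ₗ u.symm.toLinearMap)
      (hinj.comp u.symm.injective) c hc
    have hb := beta_bij J I hJI (d+1) hI l hl ⟨u.symm x, hx⟩ hcard hs M hM hJ
    obtain ⟨e⟩ := ext_old_new (X := ModuleCat.of R M) (Y := ModuleCat.of R R) d
    refine ⟨e.toAddEquiv.trans (AddEquiv.ofBijective (beta J (d+1) l hl M hJ) hb), ?_⟩
    intro r x
    ext y
    change beta J (d+1) l hl M hJ (e (r • x)) y = beta J (d+1) l hl M hJ (e x) (r • y)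
    rw [map_smul, beta_smul]

end Fin

end S14

theorem stmt_14 (p : ℕ) [Fact p.Prime] (K : Type) [Field K]
    [Algebra ℚ_[p] K] [FiniteDimensional ℚ_[p] K]
    [Algebra ℤ_[p] K] [IsScalarTower ℤ_[p] ℚ_[p] K]
    (hloc : IsLocalRing (integralClosure ℤ_[p] K))
    (hunram : @IsLocalRing.maximalIdeal _ _ hloc =
      Ideal.span {(p : integralClosure ℤ_[p] K)})
    (m : ℕ) (hm : 1 ≤ m)
    (M : Type) [AddCommGroup M]
    [Module (MvPowerSeries (Fin m) (integralClosure ℤ_[p] K)) M]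
    [Module ℤ_[p] M]
    [IsScalarTower ℤ_[p] (MvPowerSeries (Fin m) (integralClosure ℤ_[p] K)) M]
    (hM : IsFiniteLength (MvPowerSeries (Fin m) (integralClosure ℤ_[p] K)) M) :
    (∀ i : ℕ, i ≠ m + 1 →
      Subsingleton (((Ext (MvPowerSeries (Fin m) (integralClosure ℤ_[p] K))
          (ModuleCat (MvPowerSeries (Fin m) (integralClosure ℤ_[p] K))) i).obj
        (op (ModuleCat.of _ M))).obj
        (ModuleCat.of _ (MvPowerSeries (Fin m) (integralClosure ℤ_[p] K))))) ∧
    ∃ e : (((Ext (MvPowerSeries (Fin m) (integralClosure ℤ_[p] K))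
            (ModuleCat (MvPowerSeries (Fin m) (integralClosure ℤ_[p] K))) (m + 1)).obj
          (op (ModuleCat.of _ M))).obj
          (ModuleCat.of _ (MvPowerSeries (Fin m) (integralClosure ℤ_[p] K)))) ≃+
        (M →ₗ[ℤ_[p]] (ℚ_[p] ⧸ LinearMap.range (Algebra.linearMap ℤ_[p] ℚ_[p]))),
      ∀ (r : MvPowerSeries (Fin m) (integralClosure ℤ_[p] K)) (x),
        e (r • x) = (e x) ∘ₗ (DistribMulAction.toLinearMap ℤ_[p] M r) := by
  have hchar : CharZero K := charZero_of_injective_algebraMap (algebraMap ℚ_[p] K).injective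
  have hfinW : Module.Finite ℤ_[p] (integralClosure ℤ_[p] K) :=
    IsIntegralClosure.finite ℤ_[p] ℚ_[p] K (integralClosure ℤ_[p] K)
  have hp0 : (p : integralClosure ℤ_[p] K) ≠ 0 := by
    intro h
    have h2 := congrArg (fun x : integralClosure ℤ_[p] K => (x : K)) h
    simp only [ZeroMemClass.coe_zero] at h2
    have h3 : ((p : ℕ) : K) = 0 := by exact_mod_cast h2
    exact (Fact.out : p.Prime).ne_zero (Nat.cast_eq_zero.1 h3)
  have hgor := S14.gor_Imax m (integralClosure ℤ_[p] K) (p : integralClosure ℤ_[p] K)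
    (fun w hw => (mul_eq_zero.1 hw).resolve_left hp0)
  generalize integralClosure ℤ_[p] K = WW at *
  let I := S14.Imax m WW (p : WW)
  have hmaxp : (Ideal.span {(p : WW)}).IsMaximal := by
    rw [← hunram]; infer_instance
  have hImax : I.IsMaximal :=
    Ideal.comap_isMaximal_of_surjective _
      (fun w => ⟨MvPowerSeries.C w, MvPowerSeries.constantCoeff_C w⟩)
  have hfinI : Module.Finite ℤ_[p] (MvPowerSeries (Fin m) WW ⧸ I) := by
    let F : WW →ₐ[ℤ_[p]] (MvPowerSeries (Fin m) WW ⧸ I) :=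
      { ((Ideal.Quotient.mk I).comp (MvPowerSeries.C (σ := Fin m) (R := WW))) with
        commutes' := fun r => by
          change Ideal.Quotient.mk I (MvPowerSeries.C (algebraMap ℤ_[p] WW r)) = _
          rw [← MvPowerSeries.algebraMap_apply]
          rfl }
    refine Module.Finite.of_surjective F.toLinearMap ?_
    intro x
    obtain ⟨f, rfl⟩ := Ideal.Quotient.mk_surjective x
    refine ⟨MvPowerSeries.constantCoeff f, ?_⟩
    change Ideal.Quotient.mk I (MvPowerSeries.C (MvPowerSeries.constantCoeff f)) = _
    rw [Ideal.Quotient.eq]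
    change MvPowerSeries.constantCoeff _ ∈ Ideal.span {(p : WW)}
    rw [map_sub, MvPowerSeries.constantCoeff_C, sub_self]
    exact Ideal.zero_mem _
  have hpI : ((p : ℕ) : MvPowerSeries (Fin m) WW) ∈ I := by
    change MvPowerSeries.constantCoeff _ ∈ Ideal.span {(p : WW)}
    rw [map_natCast]
    exact Ideal.mem_span_singleton_self _
  have hkill : ∀ x : MvPowerSeries (Fin m) WW ⧸ I, (p : ℤ_[p]) • x = 0 := by
    intro x
    obtain ⟨f, rfl⟩ := Ideal.Quotient.mk_surjective x
    rw [Nat.cast_smul_eq_nsmul, ← map_nsmul, Ideal.Quotient.eq_zero_iff_mem, nsmul_eq_mul]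
    exact I.mul_mem_right _ hpI
  obtain ⟨hf, -, -, hc⟩ := S14.count p _ hkill
  obtain ⟨c, hc⟩ := hc inferInstance
  refine S14.main_general I m hgor (S14.baer_QZ p) ?_ c hc M hM
  intro N _ _ _ _ e
  let e' := e.restrictScalars ℤ_[p]
  have : Module.Finite ℤ_[p] N := Module.Finite.equiv e'.symm
  obtain ⟨-, h1, h2, -⟩ := S14.count p N (fun x => e'.injective (by
    rw [map_smul, hkill, map_zero]))
  exact ⟨h1, h2.trans_eq (Nat.card_congr e.toEquiv)⟩
end
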